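/- Let π be a permutation of {1,2,3,4} belonging to the Rauzy class of (4321). Then the set of length vectors L in the simplex Δ_3 such that all entries of L are strictly positive and the interval exchange transformation T_{L,π} is topologically mixing is residual in Δ_3, i.e., it contains a dense Gδ subset of Δ_3. -/

import Mathlib

open Finset MeasureTheory

namespace IETPaper

/-- The first index `0` of `Fin d` (corresponding to `1` in `{1,…,d}`). -/
def firstIdx (d : ℕ) [NeZero d] : Fin d := ⟨0, Nat.pos_of_ne_zero (NeZero.ne d)⟩

/-- The last index `d-1` of `Fin d` (corresponding to `d` in `{1,…,d}`). -/
def lastIdx (d : ℕ) [NeZero d] : Fin d :=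
  ⟨d - 1, Nat.sub_lt (Nat.pos_of_ne_zero (NeZero.ne d)) one_pos⟩

/-- Left endpoint `l₁ + ⋯ + l_{j-1}` of the `j`-th interval `I_j`. -/
noncomputable def leftEnd {d : ℕ} (L : Fin d → ℝ) (j : Fin d) : ℝ :=
  ∑ k ∈ Finset.univ.filter (fun k => k < j), L k

/-- The interval exchange transformation `T_{L,π}`: on the interval
`I_j = [leftEnd L j, leftEnd L j + L j)` it is the translation
`x ↦ x - ∑_{k < j} l_k + ∑_{π k' < π j} l_{k'}`; elsewhere it is the identity. -/
noncomputable def ietMap {d : ℕ} (π : Equiv.Perm (Fin d)) (L : Fin d → ℝ) (x : ℝ) : ℝ :=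
  if h : ∃ j : Fin d, x ∈ Set.Ico (leftEnd L j) (leftEnd L j + L j) then
    x - leftEnd L h.choose + ∑ k ∈ Finset.univ.filter (fun k => π k < π h.choose), L k
  else x

/-- Topological mixing of `T` on the subspace `X ⊆ ℝ` (with its subspace topology:
open sets of `X` are exactly the sets `U ∩ X` with `U` open in `ℝ`). -/
def TopMixingOn (T : ℝ → ℝ) (X : Set ℝ) : Prop :=
  ∀ U V : Set ℝ, IsOpen U → IsOpen V → (U ∩ X).Nonempty → (V ∩ X).Nonempty →
    ∃ N : ℕ, ∀ n : ℕ, N ≤ n → ((T^[n] '' (U ∩ X)) ∩ (V ∩ X)).Nonempty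

/-- Irreducibility of a permutation: `π {1,…,k} ≠ {1,…,k}` for all `k < d`
(0-indexed: `π` does not preserve `{j | j < k}` for `0 < k < d`). -/
def IsIrreducible {d : ℕ} (π : Equiv.Perm (Fin d)) : Prop :=
  ∀ k : ℕ, 0 < k → k < d →
    (⇑π '' {j : Fin d | (j : ℕ) < k}) ≠ {j : Fin d | (j : ℕ) < k}

/-- A permutation of `{1,…,d}` (written 0-indexed on `Fin d`) is degenerate if for some
`1 ≤ j < d` (0-indexed: `j + 1 < d`) one of the four listed conditions holds. -/
def IsDegenerate {d : ℕ} (π : Equiv.Perm (Fin d)) : Prop :=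
  ∃ j : ℕ, ∃ hj : j + 1 < d,
    ((π ⟨j + 1, hj⟩ : ℕ) = (π ⟨j, by omega⟩ : ℕ) + 1) ∨
    ((π ⟨j, by omega⟩ : ℕ) = d - 1 ∧ (π ⟨j + 1, hj⟩ : ℕ) = 0 ∧
      (π ⟨0, by omega⟩ : ℕ) = (π ⟨d - 1, by omega⟩ : ℕ) + 1) ∨
    ((π ⟨j + 1, hj⟩ : ℕ) = 0 ∧ (π ⟨0, by omega⟩ : ℕ) = (π ⟨j, by omega⟩ : ℕ) + 1) ∨
    ((π ⟨j + 1, hj⟩ : ℕ) = (π ⟨d - 1, by omega⟩ : ℕ) + 1 ∧ (π ⟨j, by omega⟩ : ℕ) = d - 1)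

/-- The Keane condition (idoc): the forward orbits of the interior discontinuities
`δ_i = leftEnd L i` (`i ≠ 0`) are pairwise disjoint infinite sets. -/
def KeaneCondition {d : ℕ} (π : Equiv.Perm (Fin d)) (L : Fin d → ℝ) : Prop :=
  ∀ i j : Fin d, (i : ℕ) ≠ 0 → (j : ℕ) ≠ 0 → ∀ m n : ℕ,
    (ietMap π L)^[m] (leftEnd L i) = (ietMap π L)^[n] (leftEnd L j) → i = j ∧ m = n

/-- `w` is an allowed block for `T_{L,π}`: some point `x` satisfies
`T^{i+1} x ∈ I_{w i}` for all positions `i` of `w` (i.e. `x ∈ ⋂ T^{-i} I_{a_i}`). -/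
def IsAllowedBlock {d : ℕ} (π : Equiv.Perm (Fin d)) (L : Fin d → ℝ)
    (w : List (Fin d)) : Prop :=
  ∃ x : ℝ, ∀ (i : ℕ) (hi : i < w.length),
    (ietMap π L)^[i + 1] x ∈
      Set.Ico (leftEnd L (w.get ⟨i, hi⟩)) (leftEnd L (w.get ⟨i, hi⟩) + L (w.get ⟨i, hi⟩))

/-- `k`-alphabet mixing: there is `N` such that for any two allowed `k`-blocks `u, v`
and any `n > N` there is an allowed `n`-block beginning with `u` and ending with `v`. -/
def AlphabetMixing {d : ℕ} (π : Equiv.Perm (Fin d)) (L : Fin d → ℝ) (k : ℕ) : Prop :=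
  ∃ N : ℕ, ∀ u v : List (Fin d), u.length = k → v.length = k →
    IsAllowedBlock π L u → IsAllowedBlock π L v →
    ∀ n : ℕ, N < n → ∃ w : List (Fin d),
      w.length = n ∧ IsAllowedBlock π L w ∧ u <+: w ∧ v <:+ w

/-- `π'` is obtained from `π` by the Rauzy move of type `a`. -/
def RauzyMoveA {d : ℕ} [NeZero d] (π π' : Equiv.Perm (Fin d)) : Prop :=
  ∀ j : Fin d,
    ((j : ℕ) ≤ (π.symm (lastIdx d) : ℕ) → π' j = π j) ∧
    ((j : ℕ) = (π.symm (lastIdx d) : ℕ) + 1 → π' j = π (lastIdx d)) ∧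
    ((π.symm (lastIdx d) : ℕ) + 1 < (j : ℕ) →
      π' j = π ⟨(j : ℕ) - 1, lt_of_le_of_lt (Nat.sub_le _ _) j.isLt⟩)

/-- `π'` is obtained from `π` by the Rauzy move of type `b`. -/
def RauzyMoveB {d : ℕ} [NeZero d] (π π' : Equiv.Perm (Fin d)) : Prop :=
  ∀ j : Fin d,
    ((π j : ℕ) ≤ (π (lastIdx d) : ℕ) → π' j = π j) ∧
    ((π (lastIdx d) : ℕ) < (π j : ℕ) → (π j : ℕ) < d - 1 →
      (π' j : ℕ) = (π j : ℕ) + 1) ∧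
    ((π j : ℕ) = d - 1 → (π' j : ℕ) = (π (lastIdx d) : ℕ) + 1)

/-- `π` is in the Rauzy class of `π₀`: reachable by finitely many moves `a`, `b`. -/
def InRauzyClass {d : ℕ} [NeZero d] (π₀ π : Equiv.Perm (Fin d)) : Prop :=
  Relation.ReflTransGen (fun p q => RauzyMoveA p q ∨ RauzyMoveB p q) π₀ π

/-- The permutation `(4321)` on `{1,2,3,4}` (0-indexed: `j ↦ 3 - j`). -/
def perm4321 : Equiv.Perm (Fin 4) := ⟨![3, 2, 1, 0], ![3, 2, 1, 0], by decide, by decide⟩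

/-- The permutation `(4213)` on `{1,2,3,4}`: `1↦4, 2↦2, 3↦1, 4↦3`. -/
def perm4213 : Equiv.Perm (Fin 4) := ⟨![3, 1, 0, 2], ![2, 1, 3, 0], by decide, by decide⟩

/-- The combinatorial data of an interval exchange transformation:
a permutation together with a length vector. -/
structure IET (d : ℕ) where
  perm : Equiv.Perm (Fin d)
  len : Fin d → ℝ

/-- The first step of Rauzy induction on `T` is of type `a`, i.e.
`δ_max = δ_+` (equivalently `l_d < l_{π⁻¹ d}`). -/
def stepA {d : ℕ} [NeZero d] (T : IET d) : Prop :=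
  T.len (lastIdx d) < T.len (T.perm.symm (lastIdx d))

/-- The first step of Rauzy induction on `T` is of type `b`, i.e.
`δ_max = δ_-` (equivalently `l_{π⁻¹ d} < l_d`). -/
def stepB {d : ℕ} [NeZero d] (T : IET d) : Prop :=
  T.len (T.perm.symm (lastIdx d)) < T.len (lastIdx d)

/-- The length vector of `R(T)` after a type `a` step (the first return map of `T`
to `[0, δ_+)`, with intervals in their natural order). -/
noncomputable def lenAfterA {d : ℕ} [NeZero d] (π : Equiv.Perm (Fin d))
    (L : Fin d → ℝ) : Fin d → ℝ := fun j =>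
  if (j : ℕ) < (π.symm (lastIdx d) : ℕ) then L j
  else if (j : ℕ) = (π.symm (lastIdx d) : ℕ) then L j - L (lastIdx d)
  else if (j : ℕ) = (π.symm (lastIdx d) : ℕ) + 1 then L (lastIdx d)
  else L ⟨(j : ℕ) - 1, lt_of_le_of_lt (Nat.sub_le _ _) j.isLt⟩

/-- The length vector of `R(T)` after a type `b` step (the first return map of `T`
to `[0, δ_-)`). -/
noncomputable def lenAfterB {d : ℕ} [NeZero d] (π : Equiv.Perm (Fin d))
    (L : Fin d → ℝ) : Fin d → ℝ := fun j =>
  if j = lastIdx d then L j - L (π.symm (lastIdx d)) else L j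

/-- `T'` is the result of one step of Rauzy induction applied to `T`
(`T' = R(T)`, un-rescaled). -/
def IsRauzyStep {d : ℕ} [NeZero d] (T T' : IET d) : Prop :=
  (stepA T ∧ RauzyMoveA T.perm T'.perm ∧ T'.len = lenAfterA T.perm T.len) ∨
  (stepB T ∧ RauzyMoveB T.perm T'.perm ∧ T'.len = lenAfterB T.perm T.len)

/-- The matrix `M(T,1)` of a type `a` step. -/
def matA {d : ℕ} [NeZero d] (π : Equiv.Perm (Fin d)) : Matrix (Fin d) (Fin d) ℤ :=
  Matrix.of fun i j =>
    if (j : ℕ) ≤ (π.symm (lastIdx d) : ℕ) then (if i = j then 1 else 0)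
    else if i = lastIdx d then (if (j : ℕ) = (π.symm (lastIdx d) : ℕ) + 1 then 1 else 0)
    else if (i : ℕ) = (j : ℕ) - 1 then 1 else 0

/-- The matrix `M(T,1)` of a type `b` step. -/
def matB {d : ℕ} [NeZero d] (π : Equiv.Perm (Fin d)) : Matrix (Fin d) (Fin d) ℤ :=
  Matrix.of fun i j =>
    if i = lastIdx d ∧ j = π.symm (lastIdx d) then 1 else if i = j then 1 else 0

open Classical in
/-- The matrix `M(T,1)` of the first step of Rauzy induction on `T`. -/
noncomputable def stepMat {d : ℕ} [NeZero d] (T : IET d) : Matrix (Fin d) (Fin d) ℤ :=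
  if stepA T then matA T.perm else matB T.perm

/-- A run of `n` steps of Rauzy induction: `seq 0 = T`, `seq (i+1) = R(seq i)`
for `i < n`.  `T` admits `n` steps of Rauzy induction iff such a chain starting
at `T` exists. -/
structure RauzyChain (d : ℕ) [NeZero d] (n : ℕ) where
  seq : ℕ → IET d
  step : ∀ i, i < n → IsRauzyStep (seq i) (seq (i + 1))

/-- The matrix `M(R^a(T), m)` of the steps `a, a+1, …, a+m-1` of a chain. -/
noncomputable def chainMatrixFrom {d n : ℕ} [NeZero d] (c : RauzyChain d n)
    (a m : ℕ) : Matrix (Fin d) (Fin d) ℤ :=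
  ((List.range m).map fun i => stepMat (c.seq (a + i))).prod

/-- The matrix `M(T, m)` of the first `m` steps of a chain starting at `T`. -/
noncomputable def chainMatrix {d n : ℕ} [NeZero d] (c : RauzyChain d n)
    (m : ℕ) : Matrix (Fin d) (Fin d) ℤ :=
  chainMatrixFrom c 0 m

/-- `|C_j(M)|`, the sum of the entries of the `j`-th column of `M`. -/
def colSum {d : ℕ} (M : Matrix (Fin d) (Fin d) ℤ) (j : Fin d) : ℤ := ∑ i, M i j

/-- `M_Δ = M ℝ₊^d ∩ Δ̊_{d-1}`: positive vectors of the cone of `M` lying in the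
interior of the standard simplex. -/
def matSimplex {d : ℕ} (M : Matrix (Fin d) (Fin d) ℤ) : Set (Fin d → ℝ) :=
  {L | (∃ v : Fin d → ℝ, (∀ i, 0 ≤ v i) ∧ L = (M.map (Int.cast : ℤ → ℝ)).mulVec v) ∧
       (∀ i, 0 < L i) ∧ ∑ i, L i = 1}

/-- `u^n`, the `n`-fold concatenation of the word `u` with itself. -/
def wpow {α : Type*} (u : List α) (n : ℕ) : List α := (List.replicate n u).flatten

/-! ### Interval exchanges over an ordered ring -/

section Generic

variable {R : Type*} [CommRing R]

/-- Left endpoint of the `j`-th interval. -/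
def lft (L : Fin 4 → R) (j : Fin 4) : R := ∑ k ∈ univ.filter (fun k => k < j), L k

/-- Left endpoint of the image of the `j`-th interval. -/
def img (π : Equiv.Perm (Fin 4)) (L : Fin 4 → R) (j : Fin 4) : R :=
  ∑ k ∈ univ.filter (fun k => π k < π j), L k

/-- Translation vector of the `j`-th interval. -/
def drift (π : Equiv.Perm (Fin 4)) (L : Fin 4 → R) (j : Fin 4) : R := img π L j - lft L j

theorem lft_comp_symm (π : Equiv.Perm (Fin 4)) (L : Fin 4 → R) (j : Fin 4) :
    lft (L ∘ π.symm) (π j) = img π L j := by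
  unfold lft img
  refine Finset.sum_equiv π.symm ?_ ?_ <;> simp

theorem img_comp_symm (π : Equiv.Perm (Fin 4)) (L : Fin 4 → R) (j : Fin 4) :
    img π.symm (L ∘ π.symm) (π j) = lft L j := by
  have := lft_comp_symm π.symm (L ∘ π.symm) (π j)
  rw [← this]
  simp [Function.comp_def]

theorem drift_comp_symm (π : Equiv.Perm (Fin 4)) (L : Fin 4 → R) (j : Fin 4) :
    drift π.symm (L ∘ π.symm) (π j) = - drift π L j := by
  simp [drift, img_comp_symm, lft_comp_symm]

theorem sum_comp_symm (π : Equiv.Perm (Fin 4)) (L : Fin 4 → R) :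
    ∑ i, (L ∘ π.symm) i = ∑ i, L i :=
  Equiv.sum_comp π.symm L

theorem lft_zero (L : Fin 4 → R) : lft L 0 = 0 := by simp [lft]

theorem lft_one (L : Fin 4 → R) : lft L 1 = L 0 := by
  simp [lft, Finset.sum_filter]

theorem lft_two (L : Fin 4 → R) : lft L 2 = L 0 + L 1 := by
  simp [lft, Finset.sum_filter, Fin.sum_univ_four]

theorem lft_three (L : Fin 4 → R) : lft L 3 = L 0 + L 1 + L 2 := by
  simp [lft, Finset.sum_filter, Fin.sum_univ_four]

theorem img_eq_zero (π : Equiv.Perm (Fin 4)) (L : Fin 4 → R) {j : Fin 4} (h : π j = 0) :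
    img π L j = 0 := by
  rw [← lft_comp_symm, h, lft_zero]

theorem lft_linear (L M : Fin 4 → R) (c d : R) (j : Fin 4) :
    lft (fun k => c * L k + d * M k) j = c * lft L j + d * lft M j := by
  simp [lft, Finset.sum_add_distrib, Finset.mul_sum]

theorem img_linear (π : Equiv.Perm (Fin 4)) (L M : Fin 4 → R) (c d : R) (j : Fin 4) :
    img π (fun k => c * L k + d * M k) j = c * img π L j + d * img π M j := by
  simp [img, Finset.sum_add_distrib, Finset.mul_sum]

theorem drift_linear (π : Equiv.Perm (Fin 4)) (L M : Fin 4 → R) (c d : R) (j : Fin 4) :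
    drift π (fun k => c * L k + d * M k) j = c * drift π L j + d * drift π M j := by
  simp only [drift, lft_linear, img_linear]; ring

variable [LinearOrder R]

/-- `x` lies in the `j`-th interval. -/
def IsAt (L : Fin 4 → R) (j : Fin 4) (x : R) : Prop := lft L j ≤ x ∧ x < lft L j + L j

open Classical in
/-- The interval exchange with data `π`, `L`, extended by the identity. -/
noncomputable def gmap (π : Equiv.Perm (Fin 4)) (L : Fin 4 → R) (x : R) : R :=
  if h : ∃ j, IsAt L j x then x + drift π L h.choose else x

theorem exists_isAt {L : Fin 4 → R} {x : R} (h0 : 0 ≤ x)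
    (h1 : x < ∑ i, L i) : ∃ j, IsAt L j x := by
  rw [Fin.sum_univ_four] at h1
  by_cases h : x < L 0
  · exact ⟨0, by rw [lft_zero]; exact h0, by rwa [lft_zero, zero_add]⟩
  by_cases h' : x < L 0 + L 1
  · exact ⟨1, by rw [lft_one]; exact not_lt.1 h, by rwa [lft_one]⟩
  by_cases h'' : x < L 0 + L 1 + L 2
  · exact ⟨2, by rw [lft_two]; exact not_lt.1 h', by rwa [lft_two]⟩
  · exact ⟨3, by rw [lft_three]; exact not_lt.1 h'', by rwa [lft_three]⟩

variable [IsStrictOrderedRing R]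

theorem lft_add_le {L : Fin 4 → R} (hL : ∀ i, 0 < L i) {j k : Fin 4} (h : j < k) :
    lft L j + L j ≤ lft L k := by
  have : lft L j + L j = ∑ i ∈ insert j (univ.filter (fun k => k < j)), L i := by
    rw [Finset.sum_insert (by simp), add_comm]; rfl
  rw [this]
  refine Finset.sum_le_sum_of_subset_of_nonneg ?_ fun i _ _ => (hL i).le
  intro i
  simp only [mem_insert, mem_filter, mem_univ, true_and]
  rintro (rfl | h')
  · exact h
  · exact h'.trans h

theorem lft_nonneg {L : Fin 4 → R} (hL : ∀ i, 0 < L i) (j : Fin 4) : 0 ≤ lft L j :=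
  Finset.sum_nonneg fun i _ => (hL i).le

theorem lft_pos {L : Fin 4 → R} (hL : ∀ i, 0 < L i) {j : Fin 4} (hj : j ≠ 0) : 0 < lft L j := by
  have := lft_add_le hL (Fin.pos_of_ne_zero hj)
  rw [lft_zero] at this
  have := hL 0
  linarith

theorem lft_add_le_sum {L : Fin 4 → R} (hL : ∀ i, 0 < L i) (j : Fin 4) :
    lft L j + L j ≤ ∑ i, L i := by
  have : lft L j + L j = ∑ i ∈ insert j (univ.filter (fun k => k < j)), L i := by
    rw [Finset.sum_insert (by simp), add_comm]; rfl
  rw [this]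
  exact Finset.sum_le_sum_of_subset_of_nonneg (subset_univ _) fun i _ _ => (hL i).le

theorem IsAt.unique {L : Fin 4 → R} (hL : ∀ i, 0 < L i) {j k : Fin 4} {x : R}
    (hj : IsAt L j x) (hk : IsAt L k x) : j = k := by
  rcases lt_trichotomy j k with h | h | h
  · exact absurd (lft_add_le hL h) (not_le.2 (lt_of_le_of_lt hk.1 hj.2))
  · exact h
  · exact absurd (lft_add_le hL h) (not_le.2 (lt_of_le_of_lt hj.1 hk.2))

theorem IsAt.mem {L : Fin 4 → R} (hL : ∀ i, 0 < L i) {j : Fin 4} {x : R} (h : IsAt L j x) :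
    0 ≤ x ∧ x < ∑ i, L i :=
  ⟨(lft_nonneg hL j).trans h.1, h.2.trans_le (lft_add_le_sum hL j)⟩

theorem isAt_lft {L : Fin 4 → R} (hL : ∀ i, 0 < L i) (j : Fin 4) : IsAt L j (lft L j) :=
  ⟨le_rfl, lt_add_of_pos_right _ (hL j)⟩

theorem gmap_of_isAt (π : Equiv.Perm (Fin 4)) {L : Fin 4 → R} (hL : ∀ i, 0 < L i) {j : Fin 4}
    {x : R} (h : IsAt L j x) : gmap π L x = x + drift π L j := by
  have h' : ∃ j, IsAt L j x := ⟨j, h⟩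
  rw [gmap, dif_pos h', h'.choose_spec.unique hL h]

theorem gmap_of_not_mem (π : Equiv.Perm (Fin 4)) {L : Fin 4 → R} (hL : ∀ i, 0 < L i)
    {x : R} (h : ¬ (0 ≤ x ∧ x < ∑ i, L i)) : gmap π L x = x := by
  rw [gmap, dif_neg]
  rintro ⟨j, hj⟩
  exact h (hj.mem hL)

theorem IsAt.gmap (π : Equiv.Perm (Fin 4)) {L : Fin 4 → R} (hL : ∀ i, 0 < L i) {j : Fin 4}
    {x : R} (h : IsAt L j x) : IsAt (L ∘ π.symm) (π j) (gmap π L x) := by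
  rw [gmap_of_isAt π hL h, IsAt, lft_comp_symm, drift]
  obtain ⟨h1, h2⟩ := h
  simp only [Function.comp_apply, Equiv.symm_apply_apply]
  constructor <;> linarith

theorem gmap_leftInverse (π : Equiv.Perm (Fin 4)) {L : Fin 4 → R} (hL : ∀ i, 0 < L i) (x : R) :
    gmap π.symm (L ∘ π.symm) (gmap π L x) = x := by
  have hL' : ∀ i, 0 < (L ∘ π.symm) i := fun i => hL _
  by_cases hx : 0 ≤ x ∧ x < ∑ i, L i
  · obtain ⟨j, hj⟩ := exists_isAt hx.1 hx.2
    rw [gmap_of_isAt π.symm hL' (hj.gmap π hL), gmap_of_isAt π hL hj, drift_comp_symm]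
    ring
  · rw [gmap_of_not_mem π hL hx, gmap_of_not_mem π.symm hL']
    rwa [sum_comp_symm]

/-- The interval exchange as a permutation. -/
noncomputable def gperm (π : Equiv.Perm (Fin 4)) (L : Fin 4 → R) (hL : ∀ i, 0 < L i) :
    Equiv.Perm R where
  toFun := gmap π L
  invFun := gmap π.symm (L ∘ π.symm)
  left_inv := gmap_leftInverse π hL
  right_inv x := by
    have := gmap_leftInverse π.symm (L := L ∘ π.symm) (fun i => hL _) x
    simpa [Function.comp_def] using this

variable (π : Equiv.Perm (Fin 4)) {L : Fin 4 → R} (hL : ∀ i, 0 < L i)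

theorem gperm_of_isAt {j : Fin 4} {x : R} (h : IsAt L j x) :
    gperm π L hL x = x + drift π L j :=
  gmap_of_isAt π hL h

theorem gperm_lft (j : Fin 4) : gperm π L hL (lft L j) = img π L j := by
  rw [gperm_of_isAt π hL (isAt_lft hL j), drift]; ring

theorem gperm_symm : (gperm π L hL).symm = gperm π.symm (L ∘ π.symm) fun _ => hL _ := by
  ext x; rfl

theorem gperm_mem {x : R} (h : 0 ≤ x ∧ x < ∑ i, L i) :
    0 ≤ gperm π L hL x ∧ gperm π L hL x < ∑ i, L i := by
  obtain ⟨j, hj⟩ := exists_isAt h.1 h.2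
  rw [← sum_comp_symm π L]
  exact (hj.gmap π hL).mem fun _ => hL _

theorem gperm_symm_mem {x : R} (h : 0 ≤ x ∧ x < ∑ i, L i) :
    0 ≤ (gperm π L hL).symm x ∧ (gperm π L hL).symm x < ∑ i, L i := by
  rw [gperm_symm, ← sum_comp_symm π L]
  rw [← sum_comp_symm π L] at h
  exact gperm_mem π.symm (fun _ => hL _) h

theorem gperm_iterate_mem {x : R} (h : 0 ≤ x ∧ x < ∑ i, L i) (n : ℕ) :
    0 ≤ (gperm π L hL)^[n] x ∧ (gperm π L hL)^[n] x < ∑ i, L i := by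
  induction n with
  | zero => exact h
  | succ n ih => rw [Function.iterate_succ_apply']; exact gperm_mem π hL ih

theorem gperm_symm_iterate_mem {x : R} (h : 0 ≤ x ∧ x < ∑ i, L i) (n : ℕ) :
    0 ≤ (gperm π L hL).symm^[n] x ∧ (gperm π L hL).symm^[n] x < ∑ i, L i := by
  induction n with
  | zero => exact h
  | succ n ih => rw [Function.iterate_succ_apply']; exact gperm_symm_mem π hL ih

theorem img_mem (hL : ∀ i, 0 < L i) (j : Fin 4) : 0 ≤ img π L j ∧ img π L j < ∑ i, L i := by
  rw [← gperm_lft π hL]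
  exact gperm_mem π hL ((isAt_lft hL j).mem hL)

theorem img_pos (hL : ∀ i, 0 < L i) {j : Fin 4} (h : π j ≠ 0) : 0 < img π L j := by
  rw [← lft_comp_symm]
  exact lft_pos (fun _ => hL _) h

end Generic

theorem ietMap_eq (π : Equiv.Perm (Fin 4)) {L : Fin 4 → ℝ} (hL : ∀ i, 0 < L i) (x : ℝ) :
    ietMap π L x = gperm π L hL x := by
  show _ = gmap π L x
  unfold ietMap
  split_ifs with h
  · have := h.choose_spec
    rw [gmap_of_isAt π hL (j := h.choose) this, drift]
    have : leftEnd L h.choose = lft L h.choose := rfl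
    rw [this, img]; ring
  · unfold gmap
    rw [dif_neg (show ¬ ∃ j, IsAt L j x from h)]

/-! ### Combinatorics of the Rauzy class of `(4321)` -/

/-- Displacement of the indices under `π`. -/
def tau (π : Equiv.Perm (Fin 4)) (k : Fin 4) : ℤ := ((π k : ℕ) : ℤ) - ((k : ℕ) : ℤ)

/-- Number of inversions of `π` between intervals whose lengths are `e`. -/
def inversions (π : Equiv.Perm (Fin 4)) (e : Fin 4 → ℕ) : ℕ :=
  ∑ k, ∑ k', if k < k' ∧ π k' < π k then e k * e k' else 0

/-- The properties of a permutation used in the construction. -/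
structure Nice (π : Equiv.Perm (Fin 4)) : Prop where
  zero : π 0 ≠ 0
  tau_sum : ∑ k, tau π k = 0
  tau_le : ∀ k, |tau π k| ≤ 3
  lft_pos : ∀ j, j ≠ 0 → 1 ≤ lft (tau π) j
  lft_le : ∀ j, lft (tau π) j ≤ 4
  img_neg : ∀ j, π j ≠ 0 → img π (tau π) j ≤ -1
  drift_neg : ∀ j, drift π (tau π) j ≤ -1
  le_drift : ∀ j, -7 ≤ drift π (tau π) j
  parity : ∃ e : Fin 4 → ℕ, (∀ i, e i ≤ 1) ∧ Odd (∑ i, e i) ∧ Odd (inversions π e)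
  nondeg : ∀ v : Fin 4 → ℚ, (∀ j, drift π v j = 0) → v = 0

/-- The seven permutations of the Rauzy class of `(4321)`. -/
def IsListed (f : Fin 4 → Fin 4) : Prop :=
  f = ![3, 2, 1, 0] ∨ f = ![3, 0, 2, 1] ∨ f = ![3, 1, 0, 2] ∨ f = ![2, 1, 3, 0] ∨
    f = ![2, 0, 3, 1] ∨ f = ![1, 3, 2, 0] ∨ f = ![1, 3, 0, 2]

instance : DecidablePred IsListed := fun f => by unfold IsListed; infer_instance

instance (p q : Equiv.Perm (Fin 4)) : Decidable (RauzyMoveA p q) := by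
  unfold RauzyMoveA; infer_instance

instance (p q : Equiv.Perm (Fin 4)) : Decidable (RauzyMoveB p q) := by
  unfold RauzyMoveB; infer_instance

theorem IsListed.step : ∀ p q : Equiv.Perm (Fin 4), IsListed p →
    (RauzyMoveA p q ∨ RauzyMoveB p q) → IsListed q := by
  decide +kernel

theorem InRauzyClass.isListed {π : Equiv.Perm (Fin 4)} (h : InRauzyClass perm4321 π) :
    IsListed π := by
  induction h with
  | refl => decide
  | tail _ hpq ih => exact ih.step _ _ hpq

theorem IsListed.nondeg {π : Equiv.Perm (Fin 4)} (h : IsListed π) (v : Fin 4 → ℚ)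
    (hv : ∀ j, drift π v j = 0) : v = 0 := by
  have h0 := hv 0
  have h1 := hv 1
  have h2 := hv 2
  have h3 := hv 3
  rcases h with h | h | h | h | h | h | h <;>
  · simp [drift, img, lft, Finset.sum_filter, Fin.sum_univ_four, h] at h0 h1 h2 h3
    funext i
    fin_cases i <;> simp <;> linarith

theorem IsListed.integral : ∀ π : Equiv.Perm (Fin 4), IsListed π →
    (π 0 ≠ 0 ∧ ∑ k, tau π k = 0 ∧ (∀ k, |tau π k| ≤ 3) ∧
    (∀ j, j ≠ 0 → 1 ≤ lft (tau π) j) ∧ (∀ j, lft (tau π) j ≤ 4) ∧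
    (∀ j, π j ≠ 0 → img π (tau π) j ≤ -1) ∧ (∀ j, drift π (tau π) j ≤ -1) ∧
    (∀ j, -7 ≤ drift π (tau π) j)) ∧
    ∃ e : Fin 4 → Fin 2, (∑ i, (e i : ℕ)) % 2 = 1 ∧ inversions π (fun i => (e i : ℕ)) % 2 = 1 := by
  decide +kernel

theorem InRauzyClass.nice {π : Equiv.Perm (Fin 4)} (h : InRauzyClass perm4321 π) : Nice π := by
  obtain ⟨⟨h1, h2, h3, h4, h5, h6, h7, h8⟩, e, he, he'⟩ := IsListed.integral π h.isListed
  exact ⟨h1, h2, h3, h4, h5, h6, h7, h8,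
    ⟨fun i => e i, fun i => Nat.le_of_lt_succ (e i).isLt, Nat.odd_iff.2 he, Nat.odd_iff.2 he'⟩, h.isListed.nondeg⟩

/-! ### Rationally independent lengths: absence of periodic points and of connections -/

section Lyapunov

variable {π : Equiv.Perm (Fin 4)} {L : Fin 4 → ℝ}

theorem exists_linearMap_tau (h : LinearIndependent ℚ L) :
    ∃ ψ : ℝ →ₗ[ℚ] ℚ, ∀ k, ψ (L k) = tau π k := by
  obtain ⟨ψ, hψ⟩ := LinearMap.exists_extend
    ((Module.Basis.span h).constr ℚ (fun k => ((tau π k : ℤ) : ℚ)))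
  refine ⟨ψ, fun k => ?_⟩
  have h1 := LinearMap.congr_fun hψ (Module.Basis.span h k)
  rw [Module.Basis.constr_basis] at h1
  rw [← h1, LinearMap.comp_apply, Submodule.subtype_apply, Module.Basis.span_apply]

variable {ψ : ℝ →ₗ[ℚ] ℚ}

theorem map_lft (hψ : ∀ k, ψ (L k) = tau π k) (j : Fin 4) : ψ (lft L j) = lft (tau π) j := by
  simp [lft, hψ]

theorem map_img (hψ : ∀ k, ψ (L k) = tau π k) (j : Fin 4) : ψ (img π L j) = img π (tau π) j := by
  simp [img, hψ]

theorem map_drift (hψ : ∀ k, ψ (L k) = tau π k) (j : Fin 4) :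
    ψ (drift π L j) = drift π (tau π) j := by
  simp [drift, map_lft hψ, map_img hψ]

theorem map_gperm_le (hψ : ∀ k, ψ (L k) = tau π k) (hn : Nice π) (hL : ∀ i, 0 < L i) {x : ℝ}
    (hx : 0 ≤ x ∧ x < ∑ i, L i) : ψ (gperm π L hL x) ≤ ψ x - 1 := by
  obtain ⟨j, hj⟩ := exists_isAt hx.1 hx.2
  rw [gperm_of_isAt π hL hj, map_add, map_drift hψ]
  have : ((drift π (tau π) j : ℤ) : ℚ) ≤ ((-1 : ℤ) : ℚ) := Int.cast_le.2 (hn.drift_neg j)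
  push_cast at this
  linarith

theorem map_iterate_le (hψ : ∀ k, ψ (L k) = tau π k) (hn : Nice π) (hL : ∀ i, 0 < L i) {x : ℝ}
    (hx : 0 ≤ x ∧ x < ∑ i, L i) (n : ℕ) : ψ ((gperm π L hL)^[n] x) ≤ ψ x - n := by
  induction n with
  | zero => simp
  | succ n ih =>
    rw [Function.iterate_succ_apply']
    have := map_gperm_le hψ hn hL (gperm_iterate_mem π hL hx n)
    push_cast
    linarith

theorem iterate_ne_self (h : LinearIndependent ℚ L) (hn : Nice π) (hL : ∀ i, 0 < L i) {x : ℝ}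
    (hx : 0 ≤ x ∧ x < ∑ i, L i) {n : ℕ} (h0 : n ≠ 0) : (gperm π L hL)^[n] x ≠ x := by
  obtain ⟨ψ, hψ⟩ := exists_linearMap_tau (π := π) h
  intro heq
  have := map_iterate_le hψ hn hL hx n
  rw [heq] at this
  have : (0 : ℚ) < n := by positivity
  linarith

theorem iterate_lft_ne (h : LinearIndependent ℚ L) (hn : Nice π) (hL : ∀ i, 0 < L i)
    (i : Fin 4) {j : Fin 4} (hj : j ≠ 0) {n : ℕ} (h0 : n ≠ 0) :
    (gperm π L hL)^[n] (lft L i) ≠ lft L j := by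
  obtain ⟨ψ, hψ⟩ := exists_linearMap_tau (π := π) h
  intro heq
  obtain ⟨n, rfl⟩ := Nat.exists_eq_succ_of_ne_zero h0
  rw [Function.iterate_succ_apply, gperm_lft] at heq
  have h1 := map_iterate_le hψ hn hL (img_mem π hL i) n
  rw [heq, map_img hψ, map_lft hψ] at h1
  have h2 : ((1 : ℤ) : ℚ) ≤ lft (tau π) j := Int.cast_le.2 (hn.lft_pos j hj)
  have h3 : ((img π (tau π) i : ℤ) : ℚ) ≤ ((0 : ℤ) : ℚ) := by
    refine Int.cast_le.2 ?_
    by_cases hi : π i = 0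
    · rw [img_eq_zero π _ hi]
    · exact (hn.img_neg i hi).trans (by norm_num)
  have : (0 : ℚ) ≤ n := by positivity
  push_cast at h2 h3
  linarith

end Lyapunov

/-! ### First returns to an interval -/

section Return

variable (π : Equiv.Perm (Fin 4)) {L : Fin 4 → ℝ} (hL : ∀ i, 0 < L i)

/-- A point of the phase space that is not an interior left endpoint stays in the same letter
over a translated interval containing no endpoint. -/
theorem isAt_of_no_endpoint (hL : ∀ i, 0 < L i) {j : Fin 4} {x y : ℝ} (hx : IsAt L j x)
    (hxy : x ≤ y) (hy : y < ∑ i, L i)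
    (hno : ∀ k, k ≠ 0 → ∀ u, x < u → u ≤ y → u ≠ lft L k) : IsAt L j y := by
  obtain ⟨k, hk⟩ := exists_isAt ((hx.mem hL).1.trans hxy) hy
  rcases lt_trichotomy j k with h | rfl | h
  · exact absurd rfl (hno k (Fin.ne_zero_of_lt h) (lft L k)
      (hx.2.trans_le (lft_add_le hL h)) hk.1)
  · exact hk
  · exact absurd (lft_add_le hL h) (not_le.2 (lt_of_le_of_lt (hx.1.trans hxy) hk.2))

/-- Points of `[s,t)` whose orbit meets an endpoint before returning. -/
def cutSet (s t : ℝ) : Set ℝ :=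
  {z | z ∈ Set.Ico s t ∧ ∃ p, ((∃ k, k ≠ 0 ∧ p = lft L k) ∨ p = s ∨ p = t) ∧
    ∃ m : ℕ, (gperm π L hL)^[m] z = p ∧
      ∀ i, 1 ≤ i → i < m → (gperm π L hL)^[i] z ∉ Set.Ico s t}

theorem cutSet_finite (s t : ℝ) : (cutSet π hL s t).Finite := by
  set T := gperm π L hL
  let P : Set ℝ := (lft L) '' Set.univ ∪ {s, t}
  have hP : P.Finite := (Set.toFinite _).union (by simp)
  let A : ℝ → Set ℝ := fun p => {z | z ∈ Set.Ico s t ∧ ∃ m : ℕ, T^[m + 1] z = p ∧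
      ∀ i, 1 ≤ i → i < m + 1 → T^[i] z ∉ Set.Ico s t}
  have key : ∀ p z z' m m', m ≤ m' → z ∈ Set.Ico s t → T^[m + 1] z = p → T^[m' + 1] z' = p →
      (∀ i, 1 ≤ i → i < m' + 1 → T^[i] z' ∉ Set.Ico s t) → z = z' := by
    intro p z z' m m' hm hz h1 h2 h3
    obtain ⟨d, rfl⟩ := Nat.exists_eq_add_of_le hm
    rw [show m + d + 1 = (m + 1) + d by ring, Function.iterate_add_apply, ← h1] at h2
    have h4 := (T.injective.iterate (m + 1)) h2
    rcases Nat.eq_zero_or_pos d with rfl | hd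
    · simpa using h4.symm
    · exact absurd (h4 ▸ hz) (h3 d hd (by omega))
  have hA : ∀ p, (A p).Finite := by
    intro p
    apply Set.Subsingleton.finite
    rintro z ⟨hz, m, h1, h2⟩ z' ⟨hz', m', h1', h2'⟩
    rcases le_total m m' with h | h
    · exact key p z z' m m' h hz h1 h1' h2'
    · exact (key p z' z m' m h hz' h1' h1 h2).symm
  refine (hP.union (hP.biUnion fun p _ => hA p)).subset ?_
  rintro z ⟨hz, p, hp, m, h1, h2⟩
  have hp' : p ∈ P := by
    rcases hp with ⟨k, -, rfl⟩ | rfl | rfl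
    · exact Or.inl ⟨k, trivial, rfl⟩
    · exact Or.inr (by simp)
    · exact Or.inr (by simp)
  rcases m with _ | m
  · left; exact (show z = p from h1) ▸ hp'
  · right; exact Set.mem_biUnion hp' ⟨hz, m, h1, h2⟩

theorem exists_close_iterates (f : ℕ → ℝ) {Λ δ : ℝ} (hδ : 0 < δ) (hf : ∀ n, 0 ≤ f n ∧ f n < Λ) :
    ∃ m m', m < m' ∧ |f m - f m'| < δ := by
  have hfin : (Set.Icc (0 : ℤ) ⌊Λ / δ⌋).Finite := Set.finite_Icc _ _
  have hmaps : ∀ n, ⌊f n / δ⌋ ∈ Set.Icc (0 : ℤ) ⌊Λ / δ⌋ := fun n =>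
    ⟨Int.floor_nonneg.2 (div_nonneg (hf n).1 hδ.le),
      Int.floor_le_floor (div_le_div_of_nonneg_right (hf n).2.le hδ.le)⟩
  obtain ⟨m, -, m', -, hne, heq⟩ := Set.infinite_univ.exists_ne_map_eq_of_mapsTo
    (f := fun n : ℕ => ⌊f n / δ⌋) (fun n _ => hmaps n) hfin
  have : |f m / δ - f m' / δ| < 1 := Int.abs_sub_lt_one_of_floor_eq_floor heq
  rw [← sub_div, abs_div, abs_of_pos hδ, div_lt_one hδ] at this
  rcases hne.lt_or_gt with h | h
  · exact ⟨m, m', h, this⟩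
  · exact ⟨m', m, h, by rwa [abs_sub_comm]⟩

theorem exists_return_piece {s t b b' : ℝ} (hs : 0 ≤ s) (ht : t ≤ ∑ i, L i) (hsb : s ≤ b)
    (hbb : b < b') (hbt : b' ≤ t) (hcut : ∀ z ∈ cutSet π hL s t, ¬ (b < z ∧ z < b')) :
    ∃ r, 1 ≤ r ∧ ∀ x ∈ Set.Ico b b', (gperm π L hL)^[r] x ∈ Set.Ico s t := by
  set T := gperm π L hL with hT
  by_contra! hcon
  have hX : ∀ x ∈ Set.Ico b b', 0 ≤ x ∧ x < ∑ i, L i := fun x hx =>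
    ⟨(hs.trans hsb).trans hx.1, hx.2.trans_le (hbt.trans ht)⟩
  have hbmem : b ∈ Set.Ico b b' := ⟨le_rfl, hbb⟩
  have main : ∀ m : ℕ, (∀ x ∈ Set.Ico b b', T^[m] x = T^[m] b + (x - b)) ∧
      ∀ i, 1 ≤ i → i ≤ m → ∀ x ∈ Set.Ico b b', T^[i] x ∉ Set.Ico s t := by
    intro m
    induction m with
    | zero => exact ⟨fun x _ => by simp, fun i h1 h2 => by omega⟩
    | succ m ih =>
      obtain ⟨ih1, ih2⟩ := ih
      have htr : ∀ x ∈ Set.Ico b b', T^[m + 1] x = T^[m + 1] b + (x - b) := by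
        intro x hx
        obtain ⟨j, hj⟩ := exists_isAt (gperm_iterate_mem π hL (hX b hbmem) m).1
          (gperm_iterate_mem π hL (hX b hbmem) m).2
        have hxm := gperm_iterate_mem π hL (hX x hx) m
        rw [← hT] at hj hxm
        have hj' : IsAt L j (T^[m] x) := by
          refine isAt_of_no_endpoint hL hj ?_ hxm.2 ?_
          · rw [ih1 x hx]; linarith [hx.1]
          · intro k hk u hu1 hu2 huk
            rw [ih1 x hx] at hu2
            have hz : b + (u - T^[m] b) ∈ Set.Ico b b' :=
              ⟨by linarith, by linarith [hx.2]⟩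
            refine hcut (b + (u - T^[m] b)) ⟨⟨hsb.trans hz.1, hz.2.trans_le hbt⟩, u,
              Or.inl ⟨k, hk, huk⟩, m, ?_, fun i h1 h2 => ih2 i h1 h2.le _ hz⟩
              ⟨by linarith, hz.2⟩
            rw [← hT, ih1 _ hz]; ring
        rw [Function.iterate_succ_apply', Function.iterate_succ_apply', hT,
          gperm_of_isAt π hL hj, ← hT, hT, gperm_of_isAt π hL hj', ← hT, ih1 x hx]
        ring
      refine ⟨htr, fun i h1 h2 => ?_⟩
      rcases h2.lt_or_eq with h2 | rfl
      · exact ih2 i h1 (by omega)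
      intro x hx hxJ
      obtain ⟨y, hy, hyJ⟩ := hcon (m + 1) h1
      have hcross : ∀ u, (u = s ∨ u = t) → T^[m + 1] b < u → u < T^[m + 1] b + (b' - b) →
          False := by
        intro u hu h3 h4
        have hz : b + (u - T^[m + 1] b) ∈ Set.Ico b b' := ⟨by linarith, by linarith⟩
        refine hcut (b + (u - T^[m + 1] b)) ⟨⟨hsb.trans hz.1, hz.2.trans_le hbt⟩, u,
          Or.inr hu, m + 1, ?_, fun i h1 h2 => ih2 i h1 (by omega) _ hz⟩
          ⟨by linarith, hz.2⟩
        rw [← hT, htr _ hz]; ring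
      rw [htr x hx] at hxJ
      rw [htr y hy, Set.mem_Ico, not_and_or, not_le, not_lt] at hyJ
      rcases hyJ with h | h
      · exact hcross s (Or.inl rfl) (by linarith [hy.1]) (by linarith [hx.2, hxJ.1])
      · exact hcross t (Or.inr rfl) (by linarith [hx.1, hxJ.2]) (by linarith [hy.2])
  obtain ⟨m, m', hmm, hclose⟩ := exists_close_iterates (fun n => T^[n] b) (sub_pos.2 hbb)
    (fun n => gperm_iterate_mem π hL (hX b hbmem) n)
  obtain ⟨d, rfl⟩ := Nat.exists_eq_add_of_lt hmm
  rw [abs_lt] at hclose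
  have hJ : ∀ x ∈ Set.Ico b b', x ∈ Set.Ico s t := fun x hx =>
    ⟨hsb.trans hx.1, hx.2.trans_le hbt⟩
  rcases le_total (T^[m] b) (T^[m + d + 1] b) with h | h
  · have hz : b + (T^[m + d + 1] b - T^[m] b) ∈ Set.Ico b b' := ⟨by linarith, by linarith⟩
    have h1 := (main m).1 _ hz
    have h2 : T^[m] (b + (T^[m + d + 1] b - T^[m] b)) = T^[m + (d + 1)] b := by
      rw [h1, ← add_assoc]; ring
    rw [Function.iterate_add_apply T m (d + 1)] at h2
    have h3 := (T.injective.iterate m) h2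
    exact (main (d + 1)).2 (d + 1) (by omega) le_rfl b hbmem (h3 ▸ hJ _ hz)
  · have hz : b + (T^[m] b - T^[m + d + 1] b) ∈ Set.Ico b b' := ⟨by linarith, by linarith⟩
    have h1 := (main (m + d + 1)).1 _ hz
    have h2 : T^[m + (d + 1)] (b + (T^[m] b - T^[m + d + 1] b)) = T^[m] b := by
      rw [← add_assoc, h1]; ring
    rw [Function.iterate_add_apply T m (d + 1)] at h2
    have h3 := (T.injective.iterate m) h2
    exact (main (d + 1)).2 (d + 1) (by omega) le_rfl _ hz (h3.symm ▸ hJ _ hbmem)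

theorem exists_return_bound {s t : ℝ} (hs : 0 ≤ s) (ht : t ≤ ∑ i, L i) :
    ∃ M : ℕ, ∀ x ∈ Set.Ico s t, ∃ i, 1 ≤ i ∧ i ≤ M ∧ (gperm π L hL)^[i] x ∈ Set.Ico s t := by
  classical
  set B : Finset ℝ := insert s (insert t (cutSet_finite π hL s t).toFinset) with hB
  have hex : ∀ p : ℝ × ℝ, ∃ r, s ≤ p.1 → p.1 < p.2 → p.2 ≤ t →
      (∀ z ∈ cutSet π hL s t, ¬ (p.1 < z ∧ z < p.2)) →
      1 ≤ r ∧ ∀ x ∈ Set.Ico p.1 p.2, (gperm π L hL)^[r] x ∈ Set.Ico s t := by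
    intro p
    by_cases h : s ≤ p.1 ∧ p.1 < p.2 ∧ p.2 ≤ t ∧
      (∀ z ∈ cutSet π hL s t, ¬ (p.1 < z ∧ z < p.2))
    · obtain ⟨r, hr⟩ := exists_return_piece π hL hs ht h.1 h.2.1 h.2.2.1 h.2.2.2
      exact ⟨r, fun _ _ _ _ => hr⟩
    · exact ⟨0, fun h1 h2 h3 h4 => absurd ⟨h1, h2, h3, h4⟩ h⟩
  choose r hr using hex
  refine ⟨(B ×ˢ B).sup r, fun x hx => ?_⟩
  have hne : (B.filter (fun z => z ≤ x)).Nonempty := ⟨s, by simp [hB, hx.1]⟩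
  have hne' : (B.filter (fun z => x < z)).Nonempty := ⟨t, by simp [hB, hx.2]⟩
  obtain ⟨b, hb, hbmax⟩ := Finset.exists_max_image _ id hne
  obtain ⟨b', hb', hbmin⟩ := Finset.exists_min_image _ id hne'
  rw [mem_filter] at hb hb'
  have hsb : s ≤ b := hbmax s (by simp [hB, hx.1])
  have hbt : b' ≤ t := hbmin t (by simp [hB, hx.2])
  obtain ⟨h1, h2⟩ := hr (b, b') hsb (hb.2.trans_lt hb'.2) hbt (by
    rintro z hz ⟨hz1, hz2⟩
    have hzB : z ∈ B := by simp [hB, hz]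
    rcases le_or_gt z x with h | h
    · exact absurd (hbmax z (by simp [hzB, h])) (not_le.2 hz1)
    · exact absurd (hbmin z (by simp [hzB, h])) (not_le.2 hz2))
  exact ⟨r (b, b'), h1, Finset.le_sup (f := r) (mem_product.2 ⟨hb.1, hb'.1⟩),
    h2 x ⟨hb.2, hb'.2⟩⟩

end Return

/-! ### Minimality -/

section Minimality

theorem finite_frontier_union {A B : Set ℝ} (hA : (frontier A).Finite) (hB : (frontier B).Finite) :
    (frontier (A ∪ B)).Finite :=
  (hA.union hB).subset <| (frontier_union_subset A B).trans
    (Set.union_subset_union Set.inter_subset_left Set.inter_subset_right)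

theorem finite_frontier_inter {A B : Set ℝ} (hA : (frontier A).Finite) (hB : (frontier B).Finite) :
    (frontier (A ∩ B)).Finite :=
  (hA.union hB).subset <| (frontier_inter_subset A B).trans
    (Set.union_subset_union Set.inter_subset_left Set.inter_subset_right)

theorem finite_frontier_Ico (s t : ℝ) : (frontier (Set.Ico s t)).Finite := by
  rcases lt_or_ge s t with h | h
  · rw [frontier_Ico h]; exact Set.toFinite _
  · simp [Set.Ico_eq_empty_of_le h]

theorem finite_frontier_biUnion {ι : Type*} (s : Finset ι) (A : ι → Set ℝ)
    (hA : ∀ i, (frontier (A i)).Finite) : (frontier (⋃ i ∈ s, A i)).Finite := by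
  classical
  induction s using Finset.induction with
  | empty => simp
  | insert a s _ ih =>
    rw [Finset.set_biUnion_insert]
    exact finite_frontier_union (hA a) ih

variable (π : Equiv.Perm (Fin 4)) {L : Fin 4 → ℝ} (hL : ∀ i, 0 < L i)

theorem finite_frontier_preimage {A : Set ℝ} (hA : (frontier A).Finite) :
    (frontier (gperm π L hL ⁻¹' A)).Finite := by
  have h : gperm π L hL ⁻¹' A = (A ∩ (Set.Ico 0 (∑ i, L i))ᶜ) ∪
      ⋃ j ∈ (univ : Finset (Fin 4)), (Set.Ico (lft L j) (lft L j + L j) ∩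
        (Homeomorph.addRight (drift π L j)) ⁻¹' A) := by
    ext x
    by_cases hx : 0 ≤ x ∧ x < ∑ i, L i
    · obtain ⟨j, hj⟩ := exists_isAt hx.1 hx.2
      simp only [Set.mem_preimage, Set.mem_union, Set.mem_inter_iff, Set.mem_compl_iff,
        Set.mem_Ico, hx, and_self, not_true_eq_false, and_false, false_or, Set.mem_iUnion,
        Finset.mem_univ, exists_const, Homeomorph.coe_addRight]
      rw [gperm_of_isAt π hL hj]
      constructor
      · exact fun h => ⟨j, hj, h⟩
      · rintro ⟨k, hk, h⟩
        rwa [IsAt.unique hL hj hk]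
    · have : gperm π L hL x = x := gmap_of_not_mem π hL hx
      simp only [Set.mem_preimage, Set.mem_union, Set.mem_inter_iff, Set.mem_compl_iff,
        Set.mem_Ico, hx, not_false_eq_true, and_true, Set.mem_iUnion, this]
      constructor
      · exact Or.inl
      · rintro (h | ⟨k, -, hk, -⟩)
        · exact h
        · exact absurd (IsAt.mem hL (j := k) hk) hx
  rw [h]
  refine finite_frontier_union (finite_frontier_inter hA ?_) (finite_frontier_biUnion _ _ ?_)
  · rw [frontier_compl]; exact finite_frontier_Ico _ _
  · intro j
    refine finite_frontier_inter (finite_frontier_Ico _ _) ?_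
    rw [← Homeomorph.preimage_frontier]
    exact hA.preimage (Homeomorph.injective _).injOn

theorem finite_frontier_preimage_iterate {A : Set ℝ} (hA : (frontier A).Finite) (n : ℕ) :
    (frontier ((gperm π L hL)^[n] ⁻¹' A)).Finite := by
  induction n with
  | zero => exact hA
  | succ n ih =>
    rw [Function.iterate_succ, Set.preimage_comp]
    exact finite_frontier_preimage π hL ih

theorem frontier_step {E : Set ℝ} (hE : ∀ x, gperm π L hL x ∈ E ↔ x ∈ E) {b : ℝ}
    (hb : 0 < b ∧ b < ∑ i, L i) (hne : ∀ k, k ≠ 0 → b ≠ lft L k) (hbE : b ∈ frontier E) :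
    (0 < gperm π L hL b ∧ gperm π L hL b < ∑ i, L i) ∧ gperm π L hL b ∈ frontier E := by
  obtain ⟨j, hj⟩ := exists_isAt hb.1.le hb.2
  have hjl : lft L j < b := by
    refine lt_of_le_of_ne hj.1 fun h => ?_
    by_cases hj0 : j = 0
    · rw [hj0, lft_zero] at h; exact hb.1.ne h
    · exact hne j hj0 h.symm
  have hgb := gperm_of_isAt π hL hj
  refine ⟨⟨?_, (gperm_mem π hL ⟨hb.1.le, hb.2⟩).2⟩, ?_⟩
  · have := (img_mem π hL j).1
    rw [hgb, drift]; linarith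
  · have ho : IsOpen (Set.Ioo (lft L j) (lft L j + L j)) := isOpen_Ioo
    have h1 : b ∈ frontier E ∩ Set.Ioo (lft L j) (lft L j + L j) := ⟨hbE, hjl, hj.2⟩
    rw [← frontier_inter_open_inter ho] at h1
    have h2 : E ∩ Set.Ioo (lft L j) (lft L j + L j) =
        (Homeomorph.addRight (drift π L j) ⁻¹' E) ∩ Set.Ioo (lft L j) (lft L j + L j) := by
      ext x
      simp only [Set.mem_inter_iff, Set.mem_preimage, Homeomorph.coe_addRight]
      refine and_congr_left fun hx => ?_
      rw [← hE x, gperm_of_isAt π hL (j := j) ⟨hx.1.le, hx.2⟩]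
    rw [h2, frontier_inter_open_inter ho, ← Homeomorph.preimage_frontier] at h1
    rw [hgb]
    exact h1.1

theorem exists_iterate_eq_lft (hn : ∀ x : ℝ, 0 ≤ x ∧ x < ∑ i, L i →
    ∀ n, n ≠ 0 → (gperm π L hL)^[n] x ≠ x) {E : Set ℝ} (hE : ∀ x, gperm π L hL x ∈ E ↔ x ∈ E)
    (hfin : (frontier E).Finite) {b : ℝ} (hb : 0 < b ∧ b < ∑ i, L i) (hbE : b ∈ frontier E) :
    ∃ m k, k ≠ 0 ∧ (gperm π L hL)^[m] b = lft L k := by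
  by_contra! hcon
  have main : ∀ m, (0 < (gperm π L hL)^[m] b ∧ (gperm π L hL)^[m] b < ∑ i, L i) ∧
      (gperm π L hL)^[m] b ∈ frontier E := by
    intro m
    induction m with
    | zero => exact ⟨hb, hbE⟩
    | succ m ih =>
      rw [Function.iterate_succ_apply']
      exact frontier_step π hL hE ih.1 (fun k hk => hcon m k hk) ih.2
  obtain ⟨m, -, m', -, hne, heq⟩ := Set.infinite_univ.exists_ne_map_eq_of_mapsTo
    (f := fun m : ℕ => (gperm π L hL)^[m] b) (fun m _ => (main m).2) hfin
  wlog hlt : m < m' generalizing m m'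
  · exact this m' m hne.symm heq.symm (lt_of_le_of_ne (not_lt.1 hlt) hne.symm)
  obtain ⟨d, rfl⟩ := Nat.exists_eq_add_of_lt hlt
  have heq' : (gperm π L hL)^[m] b = (gperm π L hL)^[m + (d + 1)] b := heq
  rw [Function.iterate_add_apply (gperm π L hL) m (d + 1)] at heq'
  exact hn b ⟨hb.1.le, hb.2⟩ (d + 1) (by omega) (((gperm π L hL).injective.iterate m) heq').symm

theorem symm_iterate_eq_iff (f : Equiv.Perm ℝ) (n : ℕ) (x y : ℝ) :
    f.symm^[n] x = y ↔ f^[n] y = x := by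
  have h1 : Function.LeftInverse f.symm^[n] f^[n] :=
    Function.LeftInverse.iterate f.left_inv n
  have h2 : Function.LeftInverse f^[n] f.symm^[n] :=
    Function.LeftInverse.iterate f.right_inv n
  constructor
  · rintro rfl; exact h2 x
  · rintro rfl; exact h1 y

theorem exists_hitting_bound (h : LinearIndependent ℚ L) (hn : Nice π) {s t : ℝ} (hs : 0 ≤ s)
    (hst : s < t) (ht : t ≤ ∑ i, L i) :
    ∃ M : ℕ, ∀ y : ℝ, 0 ≤ y ∧ y < ∑ i, L i → ∃ m, m ≤ M ∧ (gperm π L hL)^[m] y ∈ Set.Ico s t := by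
  set T := gperm π L hL with hT
  have hL' : ∀ i, 0 < (L ∘ π.symm) i := fun _ => hL _
  have hTs : T.symm = gperm π.symm (L ∘ π.symm) hL' := gperm_symm π hL
  have hsum := sum_comp_symm π L
  obtain ⟨M₁, hM₁⟩ := exists_return_bound π hL hs ht
  obtain ⟨M₂, hM₂⟩ := exists_return_bound π.symm hL' hs (ht.trans hsum.ge)
  rw [← hTs] at hM₂
  rw [← hT] at hM₁
  set M := max M₁ M₂
  set E : Set ℝ := ⋃ i ∈ Finset.range M, T.symm^[i] ⁻¹' Set.Ico s t with hEdef
  have memE : ∀ x, x ∈ E ↔ ∃ i, i < M ∧ T.symm^[i] x ∈ Set.Ico s t := by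
    intro x; simp only [hEdef, Set.mem_iUnion, Finset.mem_range, Set.mem_preimage, exists_prop]
  have hEX : ∀ x, x ∈ E ↔ T x ∈ E := by
    intro x
    rw [memE, memE]
    constructor
    · rintro ⟨i, hi, hx⟩
      rcases Nat.lt_or_ge (i + 1) M with h1 | h1
      · exact ⟨i + 1, h1, by rwa [Function.iterate_succ_apply, Equiv.symm_apply_apply]⟩
      · obtain ⟨k, hk1, hk2, hk⟩ := hM₁ _ hx
        have hkM : k ≤ i + 1 := (hk2.trans (le_max_left _ _)).trans h1
        refine ⟨i + 1 - k, by omega, ?_⟩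
        have : T.symm^[i + 1 - k] (T x) = T^[k] (T.symm^[i] x) := by
          rw [symm_iterate_eq_iff, ← Function.iterate_add_apply,
            show i + 1 - k + k = i + 1 by omega, Function.iterate_succ_apply',
            (symm_iterate_eq_iff T i x _).1 rfl]
        rwa [this]
    · rintro ⟨i, hi, hx⟩
      rcases i with _ | i
      · obtain ⟨k, hk1, hk2, hk⟩ := hM₂ _ hx
        refine ⟨k - 1, by have := le_max_right M₁ M₂; omega, ?_⟩
        obtain ⟨k, rfl⟩ := Nat.exists_eq_add_of_le' hk1
        rw [Function.iterate_succ_apply] at hk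
        simpa using hk
      · exact ⟨i, by omega, by rwa [Function.iterate_succ_apply, Equiv.symm_apply_apply] at hx⟩
  have hfin : (frontier E).Finite := by
    refine finite_frontier_biUnion _ _ fun i => ?_
    rw [hTs]
    exact finite_frontier_preimage_iterate π.symm hL' (finite_frontier_Ico s t) i
  have hnof : ∀ b, 0 < b ∧ b < ∑ i, L i → b ∉ frontier E := by
    intro b hb hbE
    obtain ⟨m, j, hj, hm⟩ := exists_iterate_eq_lft π hL
      (fun x hx n hn0 => iterate_ne_self h hn hL hx hn0) (fun x => (hEX x).symm) hfin hb hbE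
    obtain ⟨m', k, hk, hm'⟩ := exists_iterate_eq_lft π.symm hL' (fun x hx n hn0 => by
        rw [← hTs, Ne, symm_iterate_eq_iff]
        rw [hsum] at hx
        exact iterate_ne_self h hn hL hx hn0)
      (fun x => by rw [← hTs, hEX, Equiv.apply_symm_apply]) hfin (by rwa [hsum]) hbE
    rw [← hTs, symm_iterate_eq_iff] at hm'
    have hk' : lft (L ∘ π.symm) k = T (lft L (π.symm k)) := by
      rw [hT, gperm_lft, ← lft_comp_symm, Equiv.apply_symm_apply]
    rw [hk', ← Function.iterate_succ_apply] at hm'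
    rw [← hT, ← hm', ← Function.iterate_add_apply] at hm
    exact iterate_lft_ne h hn hL _ hj (by omega) hm
  have hsub : Set.Ioo 0 (∑ i, L i) ⊆ interior E := by
    refine isPreconnected_Ioo.subset_left_of_subset_union isOpen_interior
      (isOpen_interior (s := Eᶜ)) ?_ ?_ ?_
    · exact disjoint_compl_right.mono interior_subset interior_subset
    · intro b hb
      rw [← compl_frontier_eq_union_interior]
      exact hnof b hb
    · have hsub : Set.Ioo s t ⊆ E := by
        intro x hx
        rw [memE]
        have hM : 0 < M := by
          obtain ⟨i, h1, h2, -⟩ := hM₁ x ⟨hx.1.le, hx.2⟩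
          exact lt_of_lt_of_le (by omega : 0 < M₁) (le_max_left _ _)
        exact ⟨0, hM, hx.1.le, hx.2⟩
      have hmid : (s + t) / 2 ∈ Set.Ioo s t := ⟨by linarith, by linarith⟩
      exact ⟨(s + t) / 2, ⟨by linarith [hmid.1], by linarith [hmid.2]⟩,
        interior_maximal hsub isOpen_Ioo hmid⟩
  have hall : ∀ x, 0 ≤ x ∧ x < ∑ i, L i → x ∈ E := by
    intro x hx
    rcases hx.1.lt_or_eq with h0 | rfl
    · exact interior_subset (hsub ⟨h0, hx.2⟩)
    · rw [hEX]
      have h1 : T 0 = img π L 0 := by rw [← lft_zero L, hT, gperm_lft]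
      rw [h1]
      exact interior_subset (hsub ⟨img_pos π hL hn.zero, (img_mem π hL 0).2⟩)
  refine ⟨M, fun y hy => ?_⟩
  obtain ⟨i, hi, hmem⟩ := (memE _).1 (hall _ (gperm_iterate_mem π hL hy M))
  refine ⟨M - i, Nat.sub_le _ _, ?_⟩
  have : T.symm^[i] (T^[M] y) = T^[M - i] y := by
    rw [symm_iterate_eq_iff, ← Function.iterate_add_apply, Nat.add_sub_cancel' hi.le]
  rwa [← this]

end Minimality

/-! ### Integer interval exchanges: weighted displacements -/

section Discrete

/-- Sum of `F` over the atoms in `[x, y)`. -/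
noncomputable def S (F : ℤ → ℚ) (x y : ℤ) : ℚ := ∑ i ∈ Finset.Ico x y, F i

theorem S_self (F : ℤ → ℚ) (x : ℤ) : S F x x = 0 := by simp [S]

theorem S_add (F : ℤ → ℚ) {x y z : ℤ} (h : x ≤ y) (h' : y ≤ z) : S F x y + S F y z = S F x z := by
  unfold S
  rw [← Finset.sum_union (Finset.Ico_disjoint_Ico_consecutive x y z),
    Finset.Ico_union_Ico_eq_Ico h h']

theorem S_succ (F : ℤ → ℚ) {x y : ℤ} (h : x ≤ y) : S F x (y + 1) = S F x y + F y := by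
  rw [← S_add F h (by omega : y ≤ y + 1)]
  congr 1
  unfold S
  rw [Finset.sum_eq_single_of_mem y (by simp)]
  intro b hb hne
  simp only [Finset.mem_Ico] at hb
  omega

theorem S_shift (F : ℤ → ℚ) {x y d : ℤ} (h : ∀ i, x ≤ i → i < y → F (i + d) = F i) :
    S F (x + d) (y + d) = S F x y := by
  unfold S
  rw [← Finset.map_add_right_Ico, Finset.sum_map]
  refine Finset.sum_congr rfl fun i hi => ?_
  rw [Finset.mem_Ico] at hi
  exact h i hi.1 hi.2

/-- Weights of the letters. -/
noncomputable def wt (a : Fin 4 → ℤ) (F : ℤ → ℚ) (k : Fin 4) : ℚ := S F (lft a k) (lft a k + a k)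

theorem S_lft {a : Fin 4 → ℤ} (ha : ∀ i, 0 < a i) (F : ℤ → ℚ) (j : Fin 4) :
    S F 0 (lft a j) = lft (wt a F) j := by
  have h0 := ha 0
  have h1 := ha 1
  have h2 := ha 2
  have e1 : S F 0 (lft a 1) = wt a F 0 := by simp [wt, lft_zero, lft_one]
  have e2 : S F 0 (lft a 2) = wt a F 0 + wt a F 1 := by
    rw [← e1, wt, lft_one, lft_two, S_add F h0.le (by omega)]
  have e3 : S F 0 (lft a 3) = wt a F 0 + wt a F 1 + wt a F 2 := by
    rw [← e2, wt, lft_two, lft_three, S_add F (by omega) (by omega)]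
  fin_cases j
  · simp [lft_zero, S_self]
  · simpa [lft_one] using e1
  · simpa [lft_two] using e2
  · simpa [lft_three] using e3

theorem S_total {a : Fin 4 → ℤ} (ha : ∀ i, 0 < a i) (F : ℤ → ℚ) :
    S F 0 (∑ i, a i) = ∑ k, wt a F k := by
  have h := lft_add_le_sum ha 3
  have h3 := lft_nonneg ha 3
  have := ha 3
  have e : ∑ i, a i = lft a 3 + a 3 := by rw [lft_three, Fin.sum_univ_four]
  rw [Fin.sum_univ_four (wt a F), e, ← S_add F h3 (by omega), S_lft ha, lft_three]; rfl

variable (π : Equiv.Perm (Fin 4)) {a : Fin 4 → ℤ} (ha : ∀ i, 0 < a i)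

/-- Functions on the atoms that are constant along orbits. -/
def Invt (F : ℤ → ℚ) : Prop := ∀ b, 0 ≤ b ∧ b < ∑ i, a i → F (gperm π a ha b) = F b

variable {F : ℤ → ℚ}

theorem wt_comp_symm (hF : Invt π ha F) (j : Fin 4) :
    wt (a ∘ π.symm) F (π j) = wt a F j := by
  unfold wt
  rw [lft_comp_symm, Function.comp_apply, Equiv.symm_apply_apply,
    show img π a j = lft a j + drift π a j by rw [drift]; ring,
    show lft a j + drift π a j + a j = lft a j + a j + drift π a j by ring]
  refine S_shift F fun i h1 h2 => ?_
  have hj : IsAt a j i := ⟨h1, h2⟩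
  rw [← gperm_of_isAt π ha hj, hF i (hj.mem ha)]

theorem displacement (hF : Invt π ha F) {j : Fin 4} {b : ℤ} (hb : IsAt a j b) :
    S F 0 (gperm π a ha b) - S F 0 b = drift π (wt a F) j := by
  have h1 : S F 0 b = lft (wt a F) j + S F (lft a j) b := by
    rw [← S_lft ha, S_add F (lft_nonneg ha j) hb.1]
  have h2 : S F 0 (img π a j) = img π (wt a F) j := by
    rw [← lft_comp_symm, S_lft (a := a ∘ π.symm) (fun _ => ha _), ← lft_comp_symm π (wt a F)]
    congr 1
    funext k
    obtain ⟨i, rfl⟩ := π.surjective k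
    rw [wt_comp_symm π ha hF, Function.comp_apply, Equiv.symm_apply_apply]
  have h3 : S F (img π a j) (gperm π a ha b) = S F (lft a j) b := by
    rw [gperm_of_isAt π ha hb, show img π a j = lft a j + drift π a j by rw [drift]; ring]
    refine S_shift F fun i hi1 hi2 => ?_
    have hj : IsAt a j i := ⟨hi1, hi2.trans hb.2⟩
    rw [← gperm_of_isAt π ha hj, hF i (hj.mem ha)]
  have h4 : S F 0 (gperm π a ha b) = img π (wt a F) j + S F (lft a j) b := by
    rw [← h2, ← h3, S_add F (img_mem π ha j).1]
    rw [gperm_of_isAt π ha hb, drift]; linarith [hb.1]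
  rw [h4, h1, drift]; ring

theorem sum_gperm (f : ℤ → ℚ) :
    ∑ b ∈ Finset.Ico 0 (∑ i, a i), f (gperm π a ha b) = ∑ b ∈ Finset.Ico 0 (∑ i, a i), f b := by
  refine Finset.sum_equiv (gperm π a ha) ?_ fun _ _ => rfl
  intro b
  simp only [Finset.mem_Ico]
  refine ⟨gperm_mem π ha, fun h => ?_⟩
  have := gperm_symm_mem π ha h
  rwa [Equiv.symm_apply_apply] at this

theorem isotropic {F' : ℤ → ℚ} (hF : Invt π ha F) (hF' : Invt π ha F') :
    ∑ j, wt a F j * drift π (wt a F') j = 0 := by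
  set G : ℤ → ℚ := fun b => S F' 0 b
  set H : ℤ → ℚ := fun b => F b * (G (gperm π a ha b) - G b)
  have h1 : ∀ j, wt a F j * drift π (wt a F') j = wt a H j := by
    intro j
    rw [wt, wt, S, S, Finset.sum_mul]
    refine Finset.sum_congr rfl fun b hb => ?_
    rw [Finset.mem_Ico] at hb
    rw [← displacement π ha hF' (j := j) (b := b) hb]
  simp_rw [h1]
  rw [← S_total ha, S]
  have h2 := sum_gperm π ha (fun b => F b * G b)
  rw [← sub_eq_zero, ← Finset.sum_sub_distrib] at h2
  rw [← h2]
  refine Finset.sum_congr rfl fun b hb => ?_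
  rw [Finset.mem_Ico] at hb
  show F b * _ = _
  rw [hF b hb]; ring

theorem isotropic_dependent (hn : Nice π) (v : Fin 3 → Fin 4 → ℚ)
    (hv : ∀ i k, ∑ j, v i j * drift π (v k) j = 0) : ¬ LinearIndependent ℚ v := by
  intro hli
  let D : (Fin 4 → ℚ) →ₗ[ℚ] (Fin 4 → ℚ) :=
    { toFun := fun u => drift π u
      map_add' := fun u u' => by
        funext j
        simpa [Pi.add_def] using drift_linear π u u' 1 1 j
      map_smul' := fun c u => by
        funext j
        simpa [Pi.smul_def] using drift_linear π u u c 0 j }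
  have hD : LinearMap.ker D = ⊥ := by
    rw [LinearMap.ker_eq_bot']
    intro u hu
    exact hn.nondeg u fun j => congrFun hu j
  have hli' : LinearIndependent ℚ (D ∘ v) := hli.map' D hD
  let M : Matrix (Fin 3) (Fin 4) ℚ := Matrix.of v
  have hrank : M.rank = 3 := by
    have : LinearIndependent ℚ M.row := hli
    simpa using this.rank_matrix
  have hker : ∀ k, (D ∘ v) k ∈ LinearMap.ker M.mulVecLin := by
    intro k
    rw [LinearMap.mem_ker]
    funext i
    exact hv i k
  have h3 : 3 ≤ Module.finrank ℚ (LinearMap.ker M.mulVecLin) := by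
    have h := LinearIndependent.of_comp (LinearMap.ker M.mulVecLin).subtype
      (v := fun k => (⟨(D ∘ v) k, hker k⟩ : LinearMap.ker M.mulVecLin)) hli'
    simpa using h.fintype_card_le_finrank
  have h4 := M.mulVecLin.finrank_range_add_finrank_ker
  rw [show Module.finrank ℚ (LinearMap.range M.mulVecLin) = 3 from hrank] at h4
  simp at h4
  omega

/-- Functions that do not jump at orbits avoiding the endpoints. -/
def Cyl (F : ℤ → ℚ) : Prop := ∀ b, 1 ≤ b → b < ∑ i, a i →
  (∀ m j, j ≠ 0 → (gperm π a ha)^[m] b ≠ lft a j) → F (b - 1) = F b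

theorem iterate_const {α : Type*} {f : ℤ → α} {p : ℤ → Prop} {T : ℤ → ℤ} (hT : ∀ b, p b → p (T b))
    (h : ∀ b, p b → f (T b) = f b) {b : ℤ} (hb : p b) (m : ℕ) : f (T^[m] b) = f b := by
  have hp : ∀ m, p (T^[m] b) := by
    intro m
    induction m with
    | zero => exact hb
    | succ m ih => rw [Function.iterate_succ_apply']; exact hT _ ih
  induction m with
  | zero => rfl
  | succ m ih => rw [Function.iterate_succ_apply', h _ (hp m), ih]

theorem eq_zero_of_wt_eq_zero (hF : Invt π ha F) (hC : Cyl π ha F) (hw : ∀ k, wt a F k = 0) :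
    ∀ b, 0 ≤ b ∧ b < ∑ i, a i → F b = 0 := by
  have hw' : wt a F = fun _ => 0 := funext hw
  have hG : ∀ b, 0 ≤ b ∧ b < ∑ i, a i → S F 0 (gperm π a ha b) = S F 0 b := by
    intro b hb
    obtain ⟨j, hj⟩ := exists_isAt hb.1 hb.2
    rw [← sub_eq_zero, displacement π ha hF hj, hw']
    simp [drift, img, lft]
  have hGc : ∀ j, S F 0 (lft a j) = 0 := by
    intro j
    rw [S_lft ha, hw']
    simp [lft]
  have hGq : S F 0 (∑ i, a i) = 0 := by
    rw [S_total ha, hw']; simp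
  have hGF : ∀ b, 1 ≤ b → b < ∑ i, a i → S F 0 b = 0 ∨ F (b - 1) = F b := by
    intro b h1 h2
    by_cases h : ∀ m j, j ≠ 0 → (gperm π a ha)^[m] b ≠ lft a j
    · exact Or.inr (hC b h1 h2 h)
    · push Not at h
      obtain ⟨m, j, -, hm⟩ := h
      left
      rw [← hGc j, ← hm]
      exact (iterate_const (f := fun b => S F 0 b) (p := fun b => 0 ≤ b ∧ b < ∑ i, a i)
        (fun b hb => gperm_mem π ha hb) hG ⟨by omega, h2⟩ m).symm
  have main : ∀ n : ℕ, (n : ℤ) < ∑ i, a i → F n = 0 := by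
    intro n
    induction n using Nat.strong_induction_on with
    | _ n ih =>
      intro hn
      by_contra hne
      have hS : S F 0 n = 0 := by
        refine Finset.sum_eq_zero fun i hi => ?_
        rw [Finset.mem_Ico] at hi
        obtain ⟨k, rfl⟩ := Int.eq_ofNat_of_zero_le hi.1
        exact ih k (by omega) (by omega)
      have step : ∀ k : ℕ, (n : ℤ) + k < ∑ i, a i →
          F (n + k) = F n ∧ S F 0 (n + k) = k * F n := by
        intro k
        induction k with
        | zero => intro _; simp [hS]
        | succ k ihk =>
          intro hk
          push_cast at hk ⊢
          obtain ⟨h1, h2⟩ := ihk (by omega)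
          have h3 : S F 0 (n + (k + 1)) = (k + 1) * F n := by
            rw [← add_assoc, S_succ F (by omega), h2, h1]; ring
          refine ⟨?_, h3⟩
          rcases hGF (n + (k + 1)) (by omega) hk with h4 | h4
          · rw [h3] at h4
            exact absurd h4 (mul_ne_zero (by positivity) hne)
          · rw [← h4, show (n : ℤ) + (k + 1) - 1 = n + k by ring, h1]
      obtain ⟨k, hk⟩ := Int.eq_ofNat_of_zero_le (show 0 ≤ ∑ i, a i - 1 - n by omega)
      obtain ⟨h1, h2⟩ := step k (by omega)
      have h3 := S_succ F (x := 0) (y := n + k) (by omega)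
      rw [show (n : ℤ) + k + 1 = ∑ i, a i by omega, hGq, h2, h1] at h3
      have : ((k : ℚ) + 1) * F n = 0 := by linarith
      exact absurd this (mul_ne_zero (by positivity) hne)
  intro b hb
  obtain ⟨n, rfl⟩ := Int.eq_ofNat_of_zero_le hb.1
  exact main n hb.2

end Discrete

/-! ### Orbit lengths of integer interval exchanges -/

section Orbits

theorem dvd_card_of_dvd_minimalPeriod {α : Type*} [Fintype α] (σ : Equiv.Perm α) {g : ℕ}
    (h : ∀ i, g ∣ Function.minimalPeriod σ i) : g ∣ Fintype.card α := by
  classical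
  rw [Fintype.card_congr (MulAction.selfEquivSigmaOrbits (Subgroup.zpowers σ) α),
    Fintype.card_sigma]
  refine Finset.dvd_sum fun ω _ => ?_
  rw [← MulAction.minimalPeriod_eq_card]
  exact h _

variable (π : Equiv.Perm (Fin 4)) {a : Fin 4 → ℤ} (ha : ∀ i, 0 < a i)

/-- The orbit length of an atom. -/
noncomputable def ell (b : ℤ) : ℕ := Function.minimalPeriod (gperm π a ha) b

variable {n : ℕ} (hq : (n : ℤ) = ∑ i, a i)

/-- The action on the `n` atoms. -/
noncomputable def fperm : Equiv.Perm (Fin n) where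
  toFun i := ⟨(gperm π a ha (i : ℕ)).toNat, by
    have := gperm_mem π ha (x := (i : ℕ)) ⟨by omega, by omega⟩
    omega⟩
  invFun i := ⟨((gperm π a ha).symm (i : ℕ)).toNat, by
    have := gperm_symm_mem π ha (x := (i : ℕ)) ⟨by omega, by omega⟩
    omega⟩
  left_inv i := by
    have := gperm_mem π ha (x := (i : ℕ)) ⟨by omega, by omega⟩
    ext
    simp [Int.toNat_of_nonneg this.1]
  right_inv i := by
    have := gperm_symm_mem π ha (x := (i : ℕ)) ⟨by omega, by omega⟩
    ext
    simp [Int.toNat_of_nonneg this.1]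

theorem fperm_val (i : Fin n) : ((fperm π ha hq i : ℕ) : ℤ) = gperm π a ha (i : ℕ) := by
  have := gperm_mem π ha (x := (i : ℕ)) ⟨by omega, by omega⟩
  simp [fperm, Int.toNat_of_nonneg this.1]

theorem fperm_iterate_val (i : Fin n) (m : ℕ) :
    (((fperm π ha hq)^[m] i : ℕ) : ℤ) = (gperm π a ha)^[m] (i : ℕ) := by
  induction m with
  | zero => rfl
  | succ m ih => rw [Function.iterate_succ_apply', Function.iterate_succ_apply', fperm_val, ih]

theorem minimalPeriod_fperm (i : Fin n) :
    Function.minimalPeriod (fperm π ha hq) i = ell π ha (i : ℕ) := by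
  refine Function.minimalPeriod_eq_minimalPeriod_iff.2 fun m => ?_
  unfold Function.IsPeriodicPt Function.IsFixedPt
  rw [← fperm_iterate_val π ha hq, Fin.ext_iff]
  exact Int.natCast_inj.symm

theorem exists_fin (hq : (n : ℤ) = ∑ i, a i) {b : ℤ} (hb : 0 ≤ b ∧ b < ∑ i, a i) :
    ∃ i : Fin n, ((i : ℕ) : ℤ) = b :=
  ⟨⟨b.toNat, by omega⟩, by simp [Int.toNat_of_nonneg hb.1]⟩

theorem ell_pos {b : ℤ} (hb : 0 ≤ b ∧ b < ∑ i, a i) : 0 < ell π ha b := by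
  obtain ⟨n, hq⟩ := Int.eq_ofNat_of_zero_le (hb.1.trans hb.2.le)
  obtain ⟨i, rfl⟩ := exists_fin hq.symm hb
  rw [← minimalPeriod_fperm π ha hq.symm]
  refine Function.minimalPeriod_pos_of_mem_periodicPts ?_
  exact Function.Injective.mem_periodicPts (fperm π ha hq.symm).injective i

theorem ell_le (hq : (n : ℤ) = ∑ i, a i) {b : ℤ} (hb : 0 ≤ b ∧ b < ∑ i, a i) :
    ell π ha b ≤ n := by
  obtain ⟨i, rfl⟩ := exists_fin hq hb
  rw [← minimalPeriod_fperm π ha hq]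
  simpa using Function.minimalPeriod_le_card (f := fperm π ha hq) (x := i)

theorem iterate_ell (b : ℤ) : (gperm π a ha)^[ell π ha b] b = b :=
  Function.isPeriodicPt_minimalPeriod _ _

theorem ell_gperm {b : ℤ} (hb : 0 ≤ b ∧ b < ∑ i, a i) :
    ell π ha (gperm π a ha b) = ell π ha b :=
  Function.minimalPeriod_apply (Function.minimalPeriod_pos_iff_mem_periodicPts.1 (ell_pos π ha hb))

theorem dvd_of_dvd_ell (hq : (n : ℤ) = ∑ i, a i) {g : ℕ}
    (h : ∀ b, 0 ≤ b ∧ b < ∑ i, a i → g ∣ ell π ha b) : g ∣ n := by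
  have := dvd_card_of_dvd_minimalPeriod (fperm π ha hq) (g := g) fun i => by
    rw [minimalPeriod_fperm]
    exact h _ ⟨by omega, by omega⟩
  simpa using this

theorem isAt_sub_one {b : ℤ} {j : Fin 4} (hj : IsAt a j b) (hne : b ≠ lft a j) :
    IsAt a j (b - 1) ∧ gperm π a ha (b - 1) = gperm π a ha b - 1 := by
  have h : IsAt a j (b - 1) := by
    obtain ⟨h1, h2⟩ := hj
    exact ⟨by omega, by omega⟩
  refine ⟨h, ?_⟩
  rw [gperm_of_isAt π ha h, gperm_of_isAt π ha hj]; ring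

theorem ell_cyl {b : ℤ} (h1 : 1 ≤ b) (h2 : b < ∑ i, a i)
    (h : ∀ m j, j ≠ 0 → (gperm π a ha)^[m] b ≠ lft a j) : ell π ha (b - 1) = ell π ha b := by
  have main : ∀ m, (gperm π a ha)^[m] (b - 1) = (gperm π a ha)^[m] b - 1 ∧
      1 ≤ (gperm π a ha)^[m] b := by
    intro m
    induction m with
    | zero => exact ⟨rfl, h1⟩
    | succ m ih =>
      have hm := gperm_iterate_mem π ha (x := b) ⟨by omega, h2⟩ m
      obtain ⟨j, hj⟩ := exists_isAt hm.1 hm.2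
      have hne : (gperm π a ha)^[m] b ≠ lft a j := by
        by_cases hj0 : j = 0
        · rw [hj0, lft_zero]; omega
        · exact h m j hj0
      obtain ⟨h3, h4⟩ := isAt_sub_one π ha hj hne
      rw [Function.iterate_succ_apply', Function.iterate_succ_apply', ih.1]
      refine ⟨h4, ?_⟩
      have := (gperm_mem π ha (h3.mem ha)).1
      omega
  refine Function.minimalPeriod_eq_minimalPeriod_iff.2 fun m => ?_
  unfold Function.IsPeriodicPt Function.IsFixedPt
  rw [(main m).1]
  omega

theorem ell_three (hn : Nice π) {x y z : ℤ} (hx : 0 ≤ x ∧ x < ∑ i, a i)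
    (hy : 0 ≤ y ∧ y < ∑ i, a i) (hz : 0 ≤ z ∧ z < ∑ i, a i) (hxy : ell π ha x ≠ ell π ha y) :
    ell π ha z = ell π ha x ∨ ell π ha z = ell π ha y := by
  by_contra! hcon
  let v : Fin 3 → Fin 4 → ℚ := fun i => wt a (fun b => (ell π ha b : ℚ) ^ (i : ℕ))
  have hinv : ∀ i : ℕ, Invt π ha (fun b => (ell π ha b : ℚ) ^ i) := by
    intro i b hb
    simp only [ell_gperm π ha hb]
  have hdep := isotropic_dependent π hn v fun i k => isotropic π ha (hinv i) (hinv k)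
  rw [Fintype.not_linearIndependent_iff] at hdep
  obtain ⟨c, hc, i, hi⟩ := hdep
  set F : ℤ → ℚ := fun b => ∑ i : Fin 3, c i * (ell π ha b : ℚ) ^ (i : ℕ) with hF
  have hw : ∀ k, wt a F k = 0 := by
    intro k
    have := congrFun hc k
    simp only [Finset.sum_apply, Pi.smul_apply, smul_eq_mul, Pi.zero_apply] at this
    rw [← this, wt, S, hF, Finset.sum_comm]
    refine Finset.sum_congr rfl fun i _ => ?_
    rw [← Finset.mul_sum]; rfl
  have hz0 := eq_zero_of_wt_eq_zero π ha (F := F) (fun b hb => by simp only [hF, ell_gperm π ha hb])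
    (fun b h1 h2 h3 => by simp only [hF, ell_cyl π ha h1 h2 h3]) hw
  have ex := hz0 x hx
  have ey := hz0 y hy
  have ez := hz0 z hz
  simp only [hF, Fin.sum_univ_three, Fin.val_zero, Fin.val_one, Fin.val_two, pow_zero, pow_one,
    mul_one] at ex ey ez
  have nxy : (ell π ha x : ℚ) - ell π ha y ≠ 0 := sub_ne_zero.2 (by exact_mod_cast hxy)
  have nxz : (ell π ha z : ℚ) - ell π ha x ≠ 0 := sub_ne_zero.2 (by exact_mod_cast hcon.1)
  have nyz : (ell π ha z : ℚ) - ell π ha y ≠ 0 := sub_ne_zero.2 (by exact_mod_cast hcon.2)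
  have e1 : c 1 + c 2 * ((ell π ha x : ℚ) + ell π ha y) = 0 := by
    apply (mul_eq_zero.1 (?_ : ((ell π ha x : ℚ) - ell π ha y) * _ = 0)).resolve_left nxy
    linear_combination ex - ey
  have e2 : c 1 + c 2 * ((ell π ha z : ℚ) + ell π ha y) = 0 := by
    apply (mul_eq_zero.1 (?_ : ((ell π ha z : ℚ) - ell π ha y) * _ = 0)).resolve_left nyz
    linear_combination ez - ey
  have c2 : c 2 = 0 := by
    apply (mul_eq_zero.1 (?_ : ((ell π ha z : ℚ) - ell π ha x) * _ = 0)).resolve_left nxz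
    linear_combination e2 - e1
  have c1 : c 1 = 0 := by rw [c2] at e1; linarith
  have c0 : c 0 = 0 := by rw [c1, c2] at ex; linarith
  fin_cases i
  · exact hi c0
  · exact hi c1
  · exact hi c2

/-- The letter of an atom. -/
theorem exists_letter (hq : (n : ℤ) = ∑ i, a i) :
    ∃ ι : Fin n → Fin 4, ∀ i, IsAt a (ι i) ((i : ℕ) : ℤ) := by
  have : ∀ i : Fin n, ∃ j, IsAt a j ((i : ℕ) : ℤ) := fun i =>
    exists_isAt (by omega) (by omega)
  choose ι hι using this
  exact ⟨ι, hι⟩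

theorem card_letter (ha : ∀ i, 0 < a i) (hq : (n : ℤ) = ∑ i, a i) {ι : Fin n → Fin 4}
    (hι : ∀ i, IsAt a (ι i) ((i : ℕ) : ℤ)) (k : Fin 4) :
    ((univ.filter (fun i => ι i = k)).card : ℤ) = a k := by
  have h : (univ.filter (fun i => ι i = k)).map
      ⟨fun i : Fin n => ((i : ℕ) : ℤ), fun i j hij => Fin.ext (by simpa using hij)⟩ =
      Finset.Ico (lft a k) (lft a k + a k) := by
    ext b
    simp only [mem_map, mem_filter, mem_univ, true_and,
      Finset.mem_Ico]
    constructor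
    · rintro ⟨i, rfl, rfl⟩
      exact hι i
    · intro hb
      obtain ⟨i, hi⟩ := exists_fin hq (IsAt.mem ha (j := k) hb)
      exact ⟨i, (hι i).unique ha (hi ▸ hb), hi⟩
  rw [← Finset.card_map, h, Int.card_Ico]
  have := ha k
  omega

theorem sign_fperm (hodd : ∃ e : Fin 4 → ℕ, (∀ i, (e i : ℤ) % 2 = a i % 2) ∧
    Odd (inversions π e)) : Equiv.Perm.sign (fperm π ha hq) = -1 := by
  obtain ⟨ι, hι⟩ := exists_letter hq
  let g : Fin 4 → Fin 4 → ℤˣ := fun k k' => if k < k' ∧ π k' < π k then -1 else 1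
  have hval := fperm_val π ha hq
  set σ := fperm π ha hq
  have hlt : ∀ i j : Fin n, i < j → ((if σ i < σ j then 1 else -1 : ℤˣ)) = g (ι i) (ι j) := by
    intro i j hij
    have hij' : ((i : ℕ) : ℤ) < ((j : ℕ) : ℤ) := by exact_mod_cast hij
    have hσ : σ i < σ j ↔ gperm π a ha (i : ℕ) < gperm π a ha (j : ℕ) := by
      rw [← hval, ← hval]
      exact Int.ofNat_lt.symm
    rcases lt_trichotomy (ι i) (ι j) with h | h | h
    · have h1 := (hι i).gmap π ha
      have h2 := (hι j).gmap π ha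
      have hg : ∀ x, gmap π a x = gperm π a ha x := fun _ => rfl
      rw [hg] at h1 h2
      rcases lt_trichotomy (π (ι i)) (π (ι j)) with h3 | h3 | h3
      · have := lft_add_le (L := a ∘ π.symm) (fun _ => ha _) h3
        rw [if_pos (hσ.2 (h1.2.trans_le (this.trans h2.1)))]
        simp [g, h3.le]
      · exact absurd (π.injective h3) h.ne
      · have := lft_add_le (L := a ∘ π.symm) (fun _ => ha _) h3
        rw [if_neg (fun hh => absurd (hσ.1 hh) (not_lt.2 (h2.2.trans_le (this.trans h1.1)).le))]
        simp [g, h3, h]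
    · have hj := hι j
      rw [← h] at hj
      have : σ i < σ j := by
        rw [hσ, gperm_of_isAt π ha (hι i), gperm_of_isAt π ha hj]; linarith
      rw [if_pos this]
      simp [g, h]
    · exact absurd (lft_add_le ha h) (not_le.2 (((hι i).1.trans_lt hij').trans (hι j).2))
  have hge : ∀ i j : Fin n, ¬ i < j → g (ι i) (ι j) = 1 := by
    intro i j hij
    have hij' : ((j : ℕ) : ℤ) ≤ ((i : ℕ) : ℤ) := by exact_mod_cast not_lt.1 hij
    have : ¬ ι i < ι j := fun h =>
      absurd (lft_add_le ha h) (not_le.2 (((hι j).1.trans hij').trans_lt (hι i).2))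
    simp [g, this]
  have h1 : Equiv.Perm.sign σ = ∏ j, ∏ i, g (ι i) (ι j) := by
    rw [Equiv.Perm.sign_eq_prod_prod_Iio]
    refine Finset.prod_congr rfl fun j _ => ?_
    rw [← Finset.prod_subset (Finset.subset_univ (Finset.Iio j))]
    · refine Finset.prod_congr rfl fun i hi => hlt i j (Finset.mem_Iio.1 hi)
    · intro i _ hi
      exact hge i j (fun h => hi (Finset.mem_Iio.2 h))
  let N : Fin 4 → ℕ := fun k => (univ.filter (fun i => ι i = k)).card
  have hcomp : ∀ f : Fin 4 → ℤˣ, ∏ i, f (ι i) = ∏ k, f k ^ N k := by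
    intro f
    rw [← Finset.prod_fiberwise univ ι]
    refine Finset.prod_congr rfl fun k _ => ?_
    rw [Finset.prod_congr rfl (g := fun _ => f k), Finset.prod_const]
    intro i hi
    rw [(mem_filter.1 hi).2]
  have h2 : Equiv.Perm.sign σ = ∏ k', ∏ k, (g k k') ^ (N k * N k') := by
    rw [h1, hcomp (fun k' => ∏ i, g (ι i) k')]
    refine Finset.prod_congr rfl fun k' _ => ?_
    rw [hcomp (fun k => g k k'), ← Finset.prod_pow]
    refine Finset.prod_congr rfl fun k _ => ?_
    rw [pow_mul]
  obtain ⟨e, he, heodd⟩ := hodd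
  have h3 : ∀ k k', (g k k') ^ (N k * N k') =
      (-1) ^ (if k < k' ∧ π k' < π k then e k * e k' else 0) := by
    intro k k'
    have hk : ∀ k, N k % 2 = e k % 2 := by
      intro k
      have h1 := card_letter ha hq hι k
      have h2 := he k
      rw [← h1] at h2
      have : (N k : ℤ) = ((univ.filter (fun i => ι i = k)).card : ℤ) := rfl
      omega
    by_cases h : k < k' ∧ π k' < π k
    · simp only [g, if_pos h]
      have hmod : (N k * N k') % 2 = (e k * e k') % 2 := by
        rw [Nat.mul_mod, hk, hk, ← Nat.mul_mod]
      rw [Int.units_pow_eq_pow_mod_two, hmod, ← Int.units_pow_eq_pow_mod_two]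
    · simp only [g, if_neg h, one_pow, pow_zero]
  rw [h2, Finset.prod_comm]
  simp_rw [h3, Finset.prod_pow_eq_pow_sum]
  exact heodd.neg_one_pow

end Orbits

section PrimeOrbits

variable (π : Equiv.Perm (Fin 4)) {a : Fin 4 → ℤ} (ha : ∀ i, 0 < a i)
  {n : ℕ} (hq : (n : ℤ) = ∑ i, a i)

theorem ell_not_const (hq : (n : ℤ) = ∑ i, a i) (hn : Nice π) (hp : n.Prime) (hp2 : Odd n)
    (hodd : ∃ e : Fin 4 → ℕ, (∀ i, (e i : ℤ) % 2 = a i % 2) ∧ Odd (inversions π e)) (c : ℕ) :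
    ∃ b, (0 ≤ b ∧ b < ∑ i, a i) ∧ ell π ha b ≠ c := by
  by_contra! hcon
  have hpos := hp.pos
  have h00 : (0 : ℤ) ≤ 0 ∧ (0 : ℤ) < ∑ i, a i := ⟨le_rfl, by omega⟩
  rcases (Nat.dvd_prime hp).1 (dvd_of_dvd_ell π ha hq fun b hb => (hcon b hb).symm.dvd) with h | h
  · have h1 := iterate_ell π ha 0
    rw [hcon 0 h00, h, Function.iterate_one, ← lft_zero a, gperm_lft, lft_zero] at h1
    exact absurd h1 (img_pos π ha hn.zero).ne'
  · have hpow : (fperm π ha hq) ^ n = 1 := by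
      ext i
      have h1 := iterate_ell π ha ((i : ℕ) : ℤ)
      rw [hcon _ ⟨by omega, by omega⟩, h, ← fperm_iterate_val π ha hq] at h1
      rw [← Equiv.Perm.iterate_eq_pow]
      exact_mod_cast h1
    have h2 := congrArg Equiv.Perm.sign hpow
    rw [map_pow, sign_fperm π ha hq hodd, hp2.neg_one_pow, map_one] at h2
    exact absurd h2 (by decide)

theorem ell_coprime (hq : (n : ℤ) = ∑ i, a i) (hn : Nice π) (hp : n.Prime) {x y : ℤ}
    (hx : 0 ≤ x ∧ x < ∑ i, a i) (hy : 0 ≤ y ∧ y < ∑ i, a i) (hxy : ell π ha x ≠ ell π ha y) :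
    Nat.Coprime (ell π ha x) (ell π ha y) := by
  rcases (Nat.dvd_prime hp).1 (dvd_of_dvd_ell π ha hq
    (g := Nat.gcd (ell π ha x) (ell π ha y)) fun b hb => by
      rcases ell_three π ha hn hx hy hb hxy with h | h
      · rw [h]; exact Nat.gcd_dvd_left _ _
      · rw [h]; exact Nat.gcd_dvd_right _ _) with h | h
  · exact h
  · have h1 := Nat.le_of_dvd (ell_pos π ha hx) (Nat.gcd_dvd_left (ell π ha x) (ell π ha y))
    have h2 := Nat.le_of_dvd (ell_pos π ha hy) (Nat.gcd_dvd_right (ell π ha x) (ell π ha y))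
    have h3 := ell_le π ha hq hx
    have h4 := ell_le π ha hq hy
    omega

/-- The atom at whose right end a perturbed right endpoint lands. -/
def landing (π : Equiv.Perm (Fin 4)) (a : Fin 4 → ℤ) (j : Fin 4) : ℤ :=
  if π j = 0 then img π a 0 - 1 else img π a j - 1

theorem exists_ell_ne (hq : (n : ℤ) = ∑ i, a i) (hn : Nice π) (hp : n.Prime) (hp2 : Odd n)
    (h3 : ∀ i, 3 ≤ a i)
    (hodd : ∃ e : Fin 4 → ℕ, (∀ i, (e i : ℤ) % 2 = a i % 2) ∧ Odd (inversions π e)) :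
    ∃ j, j ≠ 0 ∧ ell π ha (lft a j - 1) ≠ ell π ha (landing π a j) := by
  by_contra! hcon
  have himg0 := img_pos π ha hn.zero
  set F : ℤ → ℚ := fun b => (ell π ha b : ℚ) with hF
  set P : ℤ → ℚ := fun b => if b = 0 then F (img π a 0 - 1) else F (b - 1) with hP
  have P0 : P 0 = F (img π a 0 - 1) := if_pos rfl
  have P1 : ∀ b, b ≠ 0 → P b = F (b - 1) := fun b hb => if_neg hb
  have hFI : Invt π ha F := fun b hb => by simp only [hF, ell_gperm π ha hb]
  have hPI : Invt π ha P := by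
    intro b hb
    obtain ⟨j, hj⟩ := exists_isAt hb.1 hb.2
    by_cases hbj : b = lft a j
    · rw [hbj, gperm_lft]
      by_cases hj0 : j = 0
      · rw [hj0, lft_zero, P0, P1 _ himg0.ne']
      · rw [P1 _ (lft_pos ha hj0).ne']
        have h := hcon j hj0
        unfold landing at h
        by_cases hπ : π j = 0
        · rw [if_pos hπ] at h
          rw [img_eq_zero π a hπ, P0]
          simp only [hF, h]
        · rw [if_neg hπ] at h
          rw [P1 _ (img_pos π ha hπ).ne']
          simp only [hF, h]
    · obtain ⟨h1, h2⟩ := isAt_sub_one π ha hj hbj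
      have h4 := (gperm_mem π ha (h1.mem ha)).1
      have h5 := (h1.mem ha).1
      rw [P1 _ (by omega), P1 _ (by omega), ← h2, hFI _ (h1.mem ha)]
  set D : ℤ → ℚ := fun b => F b - P b with hD
  have hDI : Invt π ha D := fun b hb => by simp only [hD, hFI b hb, hPI b hb]
  have hS : ∀ b, 1 ≤ b → S D 0 b = F (b - 1) - P 0 := by
    intro b hb
    induction b, hb using Int.leInduction with
    | base =>
      have := S_succ D (x := 0) (y := 0) le_rfl
      rw [S_self, zero_add, zero_add] at this
      rw [this]; simp [hD]
    | succ b hb ih =>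
      rw [S_succ D (by omega), ih]
      simp only [hD, P1 b (by omega), add_sub_cancel_right]
      ring
  have hw : wt a D = 0 := by
    refine hn.nondeg _ fun j => ?_
    have hj : IsAt a j (lft a j + 1) := ⟨by omega, by have := h3 j; omega⟩
    obtain ⟨h1, h2⟩ := isAt_sub_one π ha hj (by omega)
    have h4 := (gperm_mem π ha (h1.mem ha)).1
    have h5 := (h1.mem ha).1
    rw [← displacement π ha hDI hj, hS _ (by omega), hS _ (by omega), ← h2, hFI _ (h1.mem ha)]
    ring
  have hc : ∀ j, j ≠ 0 → P (lft a j) = P 0 := by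
    intro j hj
    have h1 := lft_pos ha hj
    rw [P1 _ h1.ne']
    have := S_lft ha D j
    rw [hS _ (by omega), hw, show lft (0 : Fin 4 → ℚ) j = 0 by simp [lft]] at this
    linarith
  have hlast : F (∑ i, a i - 1) = P 0 := by
    have := S_total ha D
    rw [hS _ (by have := hp.pos; omega), hw] at this
    simp only [Pi.zero_apply, Finset.sum_const_zero] at this
    linarith
  have key : ∀ b, 1 ≤ b → b < ∑ i, a i → F b = P 0 → F (b - 1) = P 0 := by
    intro b h1 h2 hb
    by_cases h : ∀ m j, j ≠ 0 → (gperm π a ha)^[m] b ≠ lft a j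
    · rw [← hb]
      simp only [hF, ell_cyl π ha h1 h2 h]
    · push Not at h
      obtain ⟨m, j, hj, hm⟩ := h
      rw [← P1 b (by omega), ← hc j hj, ← hm]
      exact (iterate_const (f := P) (p := fun b => 0 ≤ b ∧ b < ∑ i, a i)
        (fun b hb => gperm_mem π ha hb) hPI ⟨by omega, h2⟩ m).symm
  have hall : ∀ k : ℕ, (k : ℤ) < ∑ i, a i → F (∑ i, a i - 1 - k) = P 0 := by
    intro k
    induction k with
    | zero => intro _; simpa using hlast
    | succ k ih =>
      intro hk
      push_cast at hk ⊢
      rw [← sub_sub]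
      exact key _ (by omega) (by omega) (ih (by omega))
  obtain ⟨b, hb, hne⟩ := ell_not_const π ha hq hn hp hp2 hodd (ell π ha (∑ i, a i - 1))
  obtain ⟨k, hk⟩ := Int.eq_ofNat_of_zero_le (show 0 ≤ ∑ i, a i - 1 - b by omega)
  have h1 := hall k (by omega)
  rw [← hlast, show ∑ i, a i - 1 - (k : ℤ) = b by omega] at h1
  simp only [hF, Nat.cast_inj] at h1
  exact hne h1

end PrimeOrbits

/-! ### Interval exchanges close to integer ones -/

section Near

theorem lft_cast (a : Fin 4 → ℤ) (j : Fin 4) : lft (fun k => (a k : ℝ)) j = (lft a j : ℤ) := by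
  simp [lft]

theorem img_cast (π : Equiv.Perm (Fin 4)) (a : Fin 4 → ℤ) (j : Fin 4) :
    img π (fun k => (a k : ℝ)) j = (img π a j : ℤ) := by
  simp [img]

theorem lft_add_self {R : Type*} [CommRing R] (L : Fin 4 → R) (j : Fin 4) :
    lft L j + L j = ∑ i, L i ∨ ∃ k, k ≠ 0 ∧ lft L j + L j = lft L k := by
  fin_cases j
  · exact Or.inr ⟨1, by decide, by simp [lft_zero, lft_one]⟩
  · exact Or.inr ⟨2, by decide, by simp [lft_two, lft_one]⟩
  · exact Or.inr ⟨3, by decide, by simp [lft_two, lft_three]⟩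
  · exact Or.inl (by simp [Fin.sum_univ_four, lft_three])

theorem img_add_self {R : Type*} [CommRing R] (π : Equiv.Perm (Fin 4)) (L : Fin 4 → R)
    (j : Fin 4) :
    img π L j + L j = ∑ i, L i ∨ ∃ k, π k ≠ 0 ∧ img π L j + L j = img π L k := by
  have h := lft_add_self (L ∘ π.symm) (π j)
  rw [lft_comp_symm, sum_comp_symm, Function.comp_apply, Equiv.symm_apply_apply] at h
  refine h.imp id ?_
  rintro ⟨k, hk, h⟩
  refine ⟨π.symm k, by simpa using hk, ?_⟩
  rw [h, ← lft_comp_symm, Equiv.apply_symm_apply]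

theorem abs_lft_le {w : Fin 4 → ℝ} {c : ℝ} (h : ∀ k, |w k| ≤ c) (j : Fin 4) :
    |lft w j| ≤ 3 * c := by
  have h0 := abs_le.1 (h 0)
  have h1 := abs_le.1 (h 1)
  have h2 := abs_le.1 (h 2)
  rw [abs_le]
  fin_cases j
  · simp only [Fin.zero_eta, lft_zero]; constructor <;> linarith
  · simp only [Fin.mk_one, lft_one]; constructor <;> linarith
  · simp only [Fin.reduceFinMk, lft_two]; constructor <;> linarith
  · simp only [Fin.reduceFinMk, lft_three]; constructor <;> linarith

theorem abs_img_le (π : Equiv.Perm (Fin 4)) {w : Fin 4 → ℝ} {c : ℝ} (h : ∀ k, |w k| ≤ c)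
    (j : Fin 4) : |img π w j| ≤ 3 * c := by
  rw [← lft_comp_symm]
  exact abs_lft_le (fun _ => h _) _

/-- The lengths `M` deviate from the integers `a` by about `ε` times the displacement of `π`. -/
structure Approx (π : Equiv.Perm (Fin 4)) (a : Fin 4 → ℤ) (M : Fin 4 → ℝ) (ε : ℝ) : Prop where
  pos : 0 < ε
  near : ∀ k, |M k - a k - ε * tau π k| ≤ ε / 100
  sum_eq : ∑ k, M k = ((∑ k, a k : ℤ) : ℝ)

variable {π : Equiv.Perm (Fin 4)} {a : Fin 4 → ℤ} {M : Fin 4 → ℝ} {ε : ℝ}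

namespace Approx

theorem abs_lft (h : Approx π a M ε) (j : Fin 4) :
    |lft M j - lft a j - ε * (lft (tau π) j : ℤ)| ≤ 3 * (ε / 100) := by
  have := abs_lft_le h.near j
  convert this using 2
  have h1 := lft_linear (fun k => 1 * M k + (-1) * (a k : ℝ)) (fun k => (tau π k : ℝ)) 1 (-ε) j
  have h2 := lft_linear M (fun k => (a k : ℝ)) 1 (-1) j
  rw [h2, lft_cast, lft_cast] at h1
  have e : (fun k => M k - a k - ε * tau π k) =
      fun k => 1 * (1 * M k + (-1) * (a k : ℝ)) + (-ε) * (tau π k : ℝ) := by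
    funext k; ring
  rw [e, h1]; ring

theorem abs_img (h : Approx π a M ε) (j : Fin 4) :
    |img π M j - img π a j - ε * (img π (tau π) j : ℤ)| ≤ 3 * (ε / 100) := by
  have := abs_img_le π h.near j
  convert this using 2
  have h1 := img_linear π (fun k => 1 * M k + (-1) * (a k : ℝ)) (fun k => (tau π k : ℝ)) 1 (-ε) j
  have h2 := img_linear π M (fun k => (a k : ℝ)) 1 (-1) j
  rw [h2, img_cast, img_cast] at h1
  have e : (fun k => M k - a k - ε * tau π k) =
      fun k => 1 * (1 * M k + (-1) * (a k : ℝ)) + (-ε) * (tau π k : ℝ) := by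
    funext k; ring
  rw [e, h1]; ring

theorem lft_bound (h : Approx π a M ε) (hn : Nice π) (j : Fin 4) :
    ((lft a j : ℤ) : ℝ) ≤ lft M j ∧ lft M j ≤ lft a j + 5 * ε ∧ (j ≠ 0 → ((lft a j : ℤ) : ℝ) < lft M j) := by
  have hp := h.pos
  by_cases hj : j = 0
  · subst hj
    simp only [lft_zero, Int.cast_zero]
    exact ⟨le_rfl, by linarith, fun h => absurd rfl h⟩
  · have h1 := abs_le.1 (h.abs_lft j)
    have h2 : (1 : ℝ) ≤ (lft (tau π) j : ℤ) := by exact_mod_cast hn.lft_pos j hj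
    have h3 : ((lft (tau π) j : ℤ) : ℝ) ≤ 4 := by exact_mod_cast hn.lft_le j
    have h4 := mul_le_mul_of_nonneg_left h2 hp.le
    have h5 := mul_le_mul_of_nonneg_left h3 hp.le
    have : ((lft a j : ℤ) : ℝ) < lft M j := by linarith
    exact ⟨this.le, by linarith, fun _ => this⟩

theorem drift_bound (h : Approx π a M ε) (hn : Nice π) (j : Fin 4) :
    drift π a j - 8 * ε ≤ drift π M j ∧ drift π M j ≤ drift π a j - ε / 2 := by
  have hp := h.pos
  have h1 := abs_le.1 (h.abs_lft j)
  have h1' := abs_le.1 (h.abs_img j)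
  have h2 : (-7 : ℝ) ≤ (drift π (tau π) j : ℤ) := by exact_mod_cast hn.le_drift j
  have h3 : ((drift π (tau π) j : ℤ) : ℝ) ≤ -1 := by exact_mod_cast hn.drift_neg j
  have h4 := mul_le_mul_of_nonneg_left h2 hp.le
  have h5 := mul_le_mul_of_nonneg_left h3 hp.le
  simp only [drift] at *
  push_cast at *
  constructor <;> linarith

theorem img_bound (h : Approx π a M ε) (hn : Nice π) {j : Fin 4} (hj : π j ≠ 0) :
    img π a j - 8 * ε ≤ img π M j ∧ img π M j < img π a j := by
  have hp := h.pos
  have h1 := (h.drift_bound hn j).1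
  have h2 := (h.lft_bound hn j).1
  have h1' := abs_le.1 (h.abs_img j)
  have h3 : ((img π (tau π) j : ℤ) : ℝ) ≤ -1 := by exact_mod_cast hn.img_neg j hj
  have h5 := mul_le_mul_of_nonneg_left h3 hp.le
  refine ⟨?_, by linarith⟩
  simp only [drift] at h1
  push_cast at h1
  linarith

theorem le_right (h : Approx π a M ε) (hn : Nice π) (j : Fin 4) :
    ((lft a j + a j : ℤ) : ℝ) ≤ lft M j + M j := by
  have hc : ((lft a j + a j : ℤ) : ℝ) - (lft M j + M j) =
      -(lft (fun k => 1 * M k + (-1) * (a k : ℝ)) j + (1 * M j + (-1) * (a j : ℝ))) := by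
    rw [lft_linear, lft_cast]; push_cast; ring
  suffices 0 ≤ lft (fun k => 1 * M k + (-1) * (a k : ℝ)) j + (1 * M j + (-1) * (a j : ℝ)) by
    linarith
  rcases lft_add_self (fun k => 1 * M k + (-1) * (a k : ℝ)) j with h1 | ⟨k, -, h1⟩
  · rw [h1, Finset.sum_add_distrib, ← Finset.mul_sum, ← Finset.mul_sum, h.sum_eq]
    push_cast; linarith
  · rw [h1, lft_linear, lft_cast]
    linarith [(h.lft_bound hn k).1]

theorem img_right_le (h : Approx π a M ε) (hn : Nice π) (j : Fin 4) :
    img π M j + M j ≤ ((img π a j + a j : ℤ) : ℝ) := by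
  have hc : ((img π a j + a j : ℤ) : ℝ) - (img π M j + M j) =
      -(img π (fun k => 1 * M k + (-1) * (a k : ℝ)) j + (1 * M j + (-1) * (a j : ℝ))) := by
    rw [img_linear, img_cast]; push_cast; ring
  suffices img π (fun k => 1 * M k + (-1) * (a k : ℝ)) j + (1 * M j + (-1) * (a j : ℝ)) ≤ 0 by
    linarith
  rcases img_add_self π (fun k => 1 * M k + (-1) * (a k : ℝ)) j with h1 | ⟨k, hk, h1⟩
  · rw [h1, Finset.sum_add_distrib, ← Finset.mul_sum, ← Finset.mul_sum, h.sum_eq]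
    push_cast; linarith
  · rw [h1, img_linear, img_cast]
    linarith [(h.img_bound hn hk).2]

variable (ha : ∀ i, 0 < a i) (hM : ∀ i, 0 < M i)

theorem isAt_of_near (h : Approx π a M ε) (hn : Nice π) {b : ℤ} {j : Fin 4} (hb : IsAt a j b)
    {y : ℝ} (h1 : b + 5 * ε ≤ y) (h2 : y < b + 1) : IsAt M j y := by
  have hb1 : ((lft a j : ℤ) : ℝ) ≤ b := by exact_mod_cast hb.1
  have hb2 : (b : ℝ) + 1 ≤ (lft a j + a j : ℤ) := by exact_mod_cast hb.2
  exact ⟨by linarith [(h.lft_bound hn j).2.1], by linarith [h.le_right hn j]⟩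

theorem step (h : Approx π a M ε) (hn : Nice π) {b : ℤ} (hb : 0 ≤ b ∧ b < ∑ i, a i) {y σ : ℝ}
    (hσ : 10 * ε ≤ σ) (h1 : b + σ ≤ y) (h2 : y < b + 1) :
    (gperm π a ha b : ℝ) + (σ - 10 * ε) ≤ gperm π M hM y ∧
      gperm π M hM y < (gperm π a ha b : ℝ) + 1 := by
  have hp := h.pos
  obtain ⟨j, hj⟩ := exists_isAt hb.1 hb.2
  have hd := h.drift_bound hn j
  rw [gperm_of_isAt π hM (h.isAt_of_near hn hj (by linarith) h2), gperm_of_isAt π ha hj]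
  push_cast
  constructor <;> linarith

theorem track (h : Approx π a M ε) (hn : Nice π) {b : ℤ} (hb : 0 ≤ b ∧ b < ∑ i, a i) {y σ : ℝ}
    (h1 : b + σ ≤ y) (h2 : y < b + 1) (m : ℕ) (hσ : 10 * ε * m ≤ σ) :
    ((gperm π a ha)^[m] b : ℝ) + (σ - 10 * ε * m) ≤ (gperm π M hM)^[m] y ∧
      (gperm π M hM)^[m] y < ((gperm π a ha)^[m] b : ℝ) + 1 := by
  have hp := h.pos
  induction m with
  | zero => simpa using ⟨h1, h2⟩
  | succ m ih =>
    push_cast at hσ ⊢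
    obtain ⟨h3, h4⟩ := ih (by linarith)
    rw [Function.iterate_succ_apply', Function.iterate_succ_apply']
    have := h.step ha hM hn (gperm_iterate_mem π ha hb m) (σ := σ - 10 * ε * m)
      (by linarith) h3 h4
    refine ⟨?_, this.2⟩
    linarith [this.1]

theorem recover (h : Approx π a M ε) (hn : Nice π) (hε : ε ≤ 1 / 16) (k : ℕ) {y : ℝ}
    (hy : 0 ≤ y ∧ y < ∑ i, M i) (hk : Int.fract y < k * (ε / 2)) :
    ∃ m ≤ k, 1 / 2 ≤ Int.fract ((gperm π M hM)^[m] y) := by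
  have hp := h.pos
  induction k generalizing y with
  | zero =>
    simp at hk
    exact absurd (Int.fract_nonneg y) (not_le.2 hk)
  | succ k ih =>
    push_cast at hk
    obtain ⟨j, hj⟩ := exists_isAt hy.1 hy.2
    have hd := h.drift_bound hn j
    have hT := gperm_of_isAt π hM hj
    have hfl := Int.floor_add_fract y
    have hf0 := Int.fract_nonneg y
    have hf1 := Int.fract_lt_one y
    by_cases hw : 0 ≤ Int.fract y + (drift π M j - drift π a j)
    · have hfr : Int.fract (gperm π M hM y) = Int.fract y + (drift π M j - drift π a j) := by
        rw [Int.fract_eq_iff]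
        refine ⟨hw, by linarith, ⌊y⌋ + drift π a j, ?_⟩
        push_cast
        linarith
      obtain ⟨m, hm, h1⟩ := ih (gperm_mem π hM hy) (by rw [hfr]; linarith)
      exact ⟨m + 1, by omega, h1⟩
    · have hfr : Int.fract (gperm π M hM y) =
          Int.fract y + (drift π M j - drift π a j) + 1 := by
        rw [Int.fract_eq_iff]
        refine ⟨by linarith, by linarith, ⌊y⌋ + drift π a j - 1, ?_⟩
        push_cast
        linarith
      exact ⟨1, by omega, by rw [Function.iterate_one, hfr]; linarith⟩

theorem exists_run (h : Approx π a M ε) (hn : Nice π) (hε : ε ≤ 1 / 16) (N : ℕ)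
    (hN : 10 * ε * N ≤ 1 / 2) {y : ℝ} (hy : 0 ≤ y ∧ y < ∑ i, M i) :
    ∃ m ≤ 20 * N, ∃ b : ℤ, (0 ≤ b ∧ b < ∑ i, a i) ∧
      b + 10 * ε * N ≤ (gperm π M hM)^[m] y ∧ (gperm π M hM)^[m] y < b + 1 := by
  have : ∃ m ≤ 20 * N, 10 * ε * N ≤ Int.fract ((gperm π M hM)^[m] y) := by
    by_cases hf : Int.fract y < 10 * ε * N
    · obtain ⟨m, hm, h1⟩ := h.recover hM hn hε (20 * N) hy (by push_cast; linarith)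
      exact ⟨m, hm, by linarith⟩
    · exact ⟨0, by omega, not_lt.1 hf⟩
  obtain ⟨m, hm, h1⟩ := this
  have hmem := gperm_iterate_mem π hM hy m
  refine ⟨m, hm, ⌊(gperm π M hM)^[m] y⌋, ⟨Int.floor_nonneg.2 hmem.1, ?_⟩, ?_, ?_⟩
  · rw [Int.floor_lt, ← h.sum_eq]
    exact hmem.2
  · have := Int.floor_add_fract ((gperm π M hM)^[m] y)
    linarith
  · exact Int.lt_floor_add_one _

theorem landing_mem (ha : ∀ i, 0 < a i) (hn : Nice π) (j : Fin 4) :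
    0 ≤ landing π a j ∧ landing π a j < ∑ i, a i := by
  unfold landing
  split_ifs with hj
  · have := img_pos π ha hn.zero
    have := img_mem π ha 0
    omega
  · have := img_pos π ha hj
    have := img_mem π ha j
    omega

/-- The orbit of the right side of an endpoint. -/
theorem right_endpoint (h : Approx π a M ε) (hn : Nice π) (hε : ε ≤ 1 / 16) (j : Fin 4) :
    ∃ s : ℕ, 1 ≤ s ∧ s ≤ 2 ∧ (landing π a j : ℝ) + 1 / 2 ≤ (gperm π M hM)^[s] (lft M j) ∧
      (gperm π M hM)^[s] (lft M j) < (landing π a j : ℝ) + 1 := by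
  unfold landing
  split_ifs with hj
  · have := h.img_bound hn hn.zero
    refine ⟨2, by omega, le_rfl, ?_⟩
    rw [show (2 : ℕ) = 1 + 1 from rfl, Function.iterate_succ_apply, Function.iterate_one,
      gperm_lft, img_eq_zero π M hj, ← lft_zero M, gperm_lft]
    push_cast
    constructor <;> linarith
  · have := h.img_bound hn hj
    refine ⟨1, le_rfl, by omega, ?_⟩
    rw [Function.iterate_one, gperm_lft]
    push_cast
    constructor <;> linarith

/-- The orbit of the left side of an endpoint. -/
theorem left_endpoint (h : Approx π a M ε) (hn : Nice π) (hε : ε ≤ 1 / 32) {j : Fin 4}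
    (hj : j ≠ 0) :
    ∃ η₀ > 0, ∀ η, 0 < η → η < η₀ →
      (gperm π a ha (lft a j - 1) : ℝ) + 1 / 2 ≤ gperm π M hM (lft M j - η) ∧
      gperm π M hM (lft M j - η) < (gperm π a ha (lft a j - 1) : ℝ) + 1 := by
  have hp := h.pos
  obtain ⟨k, hk⟩ : ∃ k, ∀ {R : Type} [CommRing R] (L : Fin 4 → R), lft L k + L k = lft L j := by
    fin_cases j
    · exact absurd rfl hj
    · exact ⟨0, fun L => by simp [lft_zero, lft_one]⟩
    · exact ⟨1, fun L => by simp [lft_one, lft_two]⟩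
    · exact ⟨2, fun L => by simp [lft_two, lft_three]⟩
  refine ⟨min (M k) (1 / 4), lt_min (hM k) (by norm_num), fun η h0 h1 => ?_⟩
  obtain ⟨h2, h3⟩ := lt_min_iff.1 h1
  have hA : IsAt a k (lft a j - 1) := by
    rw [← hk]; exact ⟨by have := ha k; omega, by omega⟩
  have hB : IsAt M k (lft M j - η) := by
    rw [← hk]; exact ⟨by linarith, by linarith⟩
  rw [gperm_of_isAt π ha hA, gperm_of_isAt π hM hB]
  have h4 := h.img_right_le hn k
  have h5 := h.drift_bound hn k
  have h6 := h.lft_bound hn j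
  have ea := congrArg (Int.cast : ℤ → ℝ) (hk a)
  have eM := hk M
  have ed : drift π M k = img π M k - lft M k := rfl
  have eda : drift π a k = img π a k - lft a k := rfl
  rw [eda] at h5 ⊢
  push_cast at h5 h4 ea ⊢
  constructor <;> linarith

end Approx

end Near

section Core

variable {π : Equiv.Perm (Fin 4)} {a : Fin 4 → ℤ} {M : Fin 4 → ℝ} {ε : ℝ}

theorem exists_left_translate (hM : ∀ i, 0 < M i) {y : ℝ} (hy : 0 ≤ y ∧ y < ∑ i, M i) (N : ℕ)
    (h : ∀ i < N, ∀ k, (gperm π M hM)^[i] y ≠ lft M k) :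
    ∃ η₀ > 0, ∀ η, 0 < η → η < η₀ → ∀ i ≤ N,
      (gperm π M hM)^[i] (y - η) = (gperm π M hM)^[i] y - η := by
  induction N with
  | zero =>
    refine ⟨1, one_pos, fun η _ _ i hi => ?_⟩
    obtain rfl : i = 0 := by omega
    rfl
  | succ N ih =>
    obtain ⟨η₀, h0, h1⟩ := ih fun i hi => h i (by omega)
    have hm := gperm_iterate_mem π hM hy N
    obtain ⟨j, hj⟩ := exists_isAt hm.1 hm.2
    have hlt : lft M j < (gperm π M hM)^[N] y := lt_of_le_of_ne hj.1 (h N (by omega) j).symm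
    refine ⟨min η₀ ((gperm π M hM)^[N] y - lft M j), lt_min h0 (by linarith), ?_⟩
    intro η hη hη' i hi
    obtain ⟨h2, h3⟩ := lt_min_iff.1 hη'
    rcases Nat.lt_or_ge i (N + 1) with h4 | h4
    · exact h1 η hη h2 i (by omega)
    · obtain rfl : i = N + 1 := by omega
      have hj' : IsAt M j ((gperm π M hM)^[N] y - η) := ⟨by linarith, by linarith [hj.2]⟩
      rw [Function.iterate_succ_apply', Function.iterate_succ_apply', h1 η hη h2 N le_rfl,
        gperm_of_isAt π hM hj', gperm_of_isAt π hM hj]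
      ring

theorem exists_common_time (ha : ∀ i, 0 < a i) {b z : ℤ} (hb : 0 ≤ b ∧ b < ∑ i, a i)
    (hz : 0 ≤ z ∧ z < ∑ i, a i) (hco : Nat.Coprime (ell π ha b) (ell π ha z)) {P Q : ℤ → Prop}
    (hP : ∃ m, P ((gperm π a ha)^[m] b)) (hQ : ∃ m, Q ((gperm π a ha)^[m] z)) (C : ℕ) :
    ∃ t < ell π ha b * ell π ha z, P ((gperm π a ha)^[t] b) ∧ Q ((gperm π a ha)^[t + C] z) := by
  obtain ⟨p, hp⟩ := hP
  obtain ⟨r, hr⟩ := hQ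
  have h1 := ell_pos π ha hb
  have h2 := ell_pos π ha hz
  have h3 := Nat.chineseRemainder_lt_mul hco p (r + C * (ell π ha z - 1)) h1.ne' h2.ne'
  revert h3
  obtain ⟨t, ht1, ht2⟩ := Nat.chineseRemainder hco p (r + C * (ell π ha z - 1))
  intro h3
  refine ⟨t, h3, ?_, ?_⟩
  · have e : t % ell π ha b = p % ell π ha b := ht1
    rw [← Function.iterate_mod_minimalPeriod_eq]
    rw [← Function.iterate_mod_minimalPeriod_eq] at hp
    unfold ell at e
    rwa [e]
  · have e : (t + C) % ell π ha z = r % ell π ha z := by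
      have h4 := ht2.add_right C
      have h5 : r + C * (ell π ha z - 1) + C = r + C * ell π ha z := by
        obtain ⟨l, hl⟩ : ∃ l, ell π ha z = l + 1 := ⟨_, (Nat.succ_pred_eq_of_pos h2).symm⟩
        rw [hl, Nat.add_sub_cancel]; ring
      rw [h5] at h4
      rw [h4, Nat.add_mul_mod_self_right]
    rw [← Function.iterate_mod_minimalPeriod_eq]
    rw [← Function.iterate_mod_minimalPeriod_eq] at hr
    unfold ell at e
    rwa [e]

theorem Approx.mixing (h : Approx π a M ε) (hn : Nice π) (ha : ∀ i, 0 < a i)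
    (hM : ∀ i, 0 < M i) {n : ℕ} (hq : (n : ℤ) = ∑ i, a i) (hp : n.Prime) (hp2 : Odd n)
    (h3 : ∀ i, 3 ≤ a i)
    (hodd : ∃ e : Fin 4 → ℕ, (∀ i, (e i : ℤ) % 2 = a i % 2) ∧ Odd (inversions π e))
    (hε : 10 * ε * (21 * n ^ 2 + 30) ≤ 1 / 2)
    (hne : ∀ i j, j ≠ 0 → ∀ m, m ≠ 0 → (gperm π M hM)^[m] (lft M i) ≠ lft M j) {P Q : ℤ → Prop}
    (hP : ∀ b, 0 ≤ b ∧ b < ∑ i, a i → ∃ m, P ((gperm π a ha)^[m] b))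
    (hQ : ∀ b, 0 ≤ b ∧ b < ∑ i, a i → ∃ m, Q ((gperm π a ha)^[m] b)) {K : ℕ}
    (hK : 21 * n ^ 2 + 30 ≤ K) :
    ∃ z b c, P b ∧ Q c ∧ (b : ℝ) ≤ z ∧ z < b + 1 ∧
      (c : ℝ) ≤ (gperm π M hM)^[K] z ∧ (gperm π M hM)^[K] z < c + 1 := by
  have hε0 := h.pos
  have hε1 : ε ≤ 1 / 32 := by nlinarith [sq_nonneg (n : ℝ)]
  have hεm : ∀ m : ℕ, m ≤ 21 * n ^ 2 + 30 → 10 * ε * m ≤ 1 / 2 := by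
    intro m hm
    have hm' : (m : ℝ) ≤ 21 * (n : ℝ) ^ 2 + 30 := by exact_mod_cast hm
    exact (mul_le_mul_of_nonneg_left hm' (by positivity)).trans hε
  obtain ⟨j, hj0, hj⟩ := exists_ell_ne π ha hq hn hp hp2 h3 hodd
  obtain ⟨N, rfl⟩ := Nat.exists_eq_add_of_le (show 2 ≤ K by omega)
  obtain ⟨w, hw⟩ : ∃ w, w = (gperm π M hM).symm^[N] (lft M j) := ⟨_, rfl⟩
  have hδ := (isAt_lft hM j).mem hM
  have hwm : 0 ≤ w ∧ w < ∑ i, M i := hw ▸ gperm_symm_iterate_mem π hM hδ N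
  have hTw : (gperm π M hM)^[N] w = lft M j := (symm_iterate_eq_iff _ _ _ _).1 hw.symm
  obtain ⟨η₁, hη₁, hleft⟩ := exists_left_translate (π := π) hM hwm N fun i hi k hik => by
    refine hne k j hj0 (N - i) (by omega) ?_
    rw [← hik, ← Function.iterate_add_apply, Nat.sub_add_cancel hi.le, hTw]
  obtain ⟨m₀, hm₀, b, hb, hb1, hb2⟩ :=
    h.exists_run hM hn (by linarith) (n ^ 2 + 1) (hεm _ (by omega)) hwm
  have hcj : 0 ≤ lft a j - 1 ∧ lft a j - 1 < ∑ i, a i := by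
    have h1 := lft_pos ha hj0
    have h2 := ((isAt_lft ha j).mem ha).2
    omega
  have hZ := Approx.landing_mem ha hn j
  have hbound : ∀ {z}, 0 ≤ z ∧ z < ∑ i, a i → ∀ {t}, t < ell π ha b * ell π ha z → t ≤ n ^ 2 := by
    intro z hz t ht
    rw [pow_two]
    exact ht.le.trans (Nat.mul_le_mul (ell_le π ha hq hb) (ell_le π ha hq hz))
  have hpre : ∀ t : ℕ, t ≤ n ^ 2 →
      ((gperm π a ha)^[t] b : ℝ) + 10 * ε ≤ (gperm π M hM)^[m₀ + t] w ∧
      (gperm π M hM)^[m₀ + t] w < ((gperm π a ha)^[t] b : ℝ) + 1 := by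
    intro t ht
    have ht' : (t : ℝ) + 1 ≤ ((n ^ 2 + 1 : ℕ) : ℝ) := by exact_mod_cast Nat.succ_le_succ ht
    have h1 := mul_le_mul_of_nonneg_left ht' (show 0 ≤ 10 * ε by positivity)
    have h2 := h.track ha hM hn hb hb1 hb2 t (by linarith)
    rw [add_comm m₀, Function.iterate_add_apply]
    exact ⟨by linarith, h2.2⟩
  have hdich : ell π ha b ≠ ell π ha (landing π a j) ∨ ell π ha b ≠ ell π ha (lft a j - 1) := by
    by_contra! hcon
    exact hj (hcon.2.symm.trans hcon.1)
  rcases hdich with hd | hd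
  · obtain ⟨s, hs1, hs2, hs3, hs4⟩ := h.right_endpoint hM hn (by linarith) j
    obtain ⟨t, ht, htP, htQ⟩ := exists_common_time ha hb hZ (ell_coprime π ha hq hn hp hb hZ hd)
      (hP b hb) (hQ _ hZ) (m₀ + 2 - s)
    have htn := hbound hZ ht
    have htr := h.track ha hM hn hZ hs3 hs4 (t + (m₀ + 2 - s)) (hεm _ (by omega))
    have hεr := hεm (t + (m₀ + 2 - s)) (by omega)
    have hz := hpre t htn
    refine ⟨(gperm π M hM)^[m₀ + t] w, _, _, htP, htQ, by linarith [hz.1], hz.2, ?_⟩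
    rw [← Function.iterate_add_apply] at htr
    rw [← Function.iterate_add_apply,
      show 2 + N + (m₀ + t) = (t + (m₀ + 2 - s) + s) + N by omega,
      Function.iterate_add_apply _ _ N, hTw]
    exact ⟨by linarith [htr.1], htr.2⟩
  · have hX := gperm_mem π ha hcj
    rw [← ell_gperm π ha hcj] at hd
    obtain ⟨t, ht, htP, htQ⟩ := exists_common_time ha hb hX (ell_coprime π ha hq hn hp hb hX hd)
      (hP b hb) (hQ _ hX) (m₀ + 1)
    have htn := hbound hX ht
    obtain ⟨η₀, hη₀, hend⟩ := h.left_endpoint ha hM hn hε1 hj0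
    obtain ⟨η, hη, hη'⟩ := exists_between (lt_min (lt_min hη₀ hη₁) (show 0 < 10 * ε by positivity))
    obtain ⟨hη'', hη3⟩ := lt_min_iff.1 hη'
    obtain ⟨hη1, hη2⟩ := lt_min_iff.1 hη''
    obtain ⟨hs3, hs4⟩ := hend η hη hη1
    have htr := h.track ha hM hn hX hs3 hs4 (t + (m₀ + 1)) (hεm _ (by omega))
    have hεr := hεm (t + (m₀ + 1)) (by omega)
    have hz := hpre t htn
    refine ⟨(gperm π M hM)^[m₀ + t] w - η, _, _, htP, htQ, by linarith [hz.1],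
      by linarith [hz.2], ?_⟩
    rw [← Function.iterate_succ_apply (gperm π M hM)] at htr
    rw [← hleft η hη hη2 _ (by omega), ← Function.iterate_add_apply,
      show 2 + N + (m₀ + t) = (t + (m₀ + 1)).succ + N by omega,
      Function.iterate_add_apply _ _ N, hleft η hη hη2 N le_rfl, hTw]
    exact ⟨by linarith [htr.1], htr.2⟩

end Core

/-! ### Topological mixing of well approximated interval exchanges -/

section Mixing

theorem lft_mul (c : ℝ) (L : Fin 4 → ℝ) (j : Fin 4) : lft (fun i => c * L i) j = c * lft L j := by
  simp [lft, Finset.mul_sum]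

theorem drift_mul (π : Equiv.Perm (Fin 4)) (c : ℝ) (L : Fin 4 → ℝ) (j : Fin 4) :
    drift π (fun i => c * L i) j = c * drift π L j := by
  simp [drift, lft, img, Finset.mul_sum, mul_sub]

theorem gperm_mul_iterate (π : Equiv.Perm (Fin 4)) {L : Fin 4 → ℝ} (hL : ∀ i, 0 < L i) {c : ℝ}
    (hc : 0 < c) (hM : ∀ i, 0 < c * L i) {x : ℝ} (hx : 0 ≤ x ∧ x < ∑ i, L i) (m : ℕ) :
    (gperm π (fun i => c * L i) hM)^[m] (c * x) = c * (gperm π L hL)^[m] x := by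
  induction m with
  | zero => rfl
  | succ m ih =>
    have hm := gperm_iterate_mem π hL hx m
    obtain ⟨j, hj⟩ := exists_isAt hm.1 hm.2
    have hj' : IsAt (fun i => c * L i) j (c * (gperm π L hL)^[m] x) := by
      unfold IsAt
      rw [lft_mul, ← mul_add]
      exact ⟨mul_le_mul_of_nonneg_left hj.1 hc.le, mul_lt_mul_of_pos_left hj.2 hc⟩
    rw [Function.iterate_succ_apply', Function.iterate_succ_apply', ih, gperm_of_isAt π hM hj',
      gperm_of_isAt π hL hj, drift_mul]
    ring

/-- The size of the prescribed deviation from integer lengths with sum `n`. -/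
noncomputable def deviation (n : ℕ) : ℝ := 1 / (10000 * (n : ℝ) ^ 2)

theorem deviation_pos {n : ℕ} (hn : 0 < n) : 0 < deviation n := by
  have : (0 : ℝ) < n := by exact_mod_cast hn
  unfold deviation; positivity

/-- Integer lengths suitable for approximating an interval exchange with permutation `π`. -/
structure Admissible (π : Equiv.Perm (Fin 4)) (n : ℕ) (a : Fin 4 → ℤ) : Prop where
  prime : n.Prime
  odd : Odd n
  sum_eq : (n : ℤ) = ∑ i, a i
  three_le : ∀ i, 3 ≤ a i
  parity : ∃ e : Fin 4 → ℕ, (∀ i, (e i : ℤ) % 2 = a i % 2) ∧ Odd (inversions π e)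

variable {π : Equiv.Perm (Fin 4)} {L : Fin 4 → ℝ}

/-- An open set around a point contains all atoms that meet a small interval, and this interval
is visited in bounded time. -/
theorem exists_atoms (hL : ∀ i, 0 < L i) (hsum : ∑ i, L i = 1) (h : LinearIndependent ℚ L)
    (hn : Nice π) {U : Set ℝ} (hU : IsOpen U) (hne : (U ∩ Set.Ico (0 : ℝ) 1).Nonempty) :
    ∃ k : ℕ, ∀ n, k ≤ n → ∀ a, Admissible π n a → ∀ ha : ∀ i, 0 < a i,
      Approx π a (fun i => (n : ℝ) * L i) (deviation n) → ∃ P : ℤ → Prop,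
        (∀ b, 0 ≤ b ∧ b < ∑ i, a i → ∃ m, P ((gperm π a ha)^[m] b)) ∧
        ∀ b z, P b → (b : ℝ) ≤ (n : ℝ) * z → (n : ℝ) * z < b + 1 →
          z ∈ U ∩ Set.Ico (0 : ℝ) 1 := by
  obtain ⟨x, hxU, hx0, hx1⟩ := hne
  obtain ⟨ρ, hρ, hball⟩ := Metric.isOpen_iff.1 hU x hxU
  obtain ⟨r, hr0, hr⟩ := exists_between (lt_min (half_pos hρ) (sub_pos.2 hx1))
  obtain ⟨hr1, hr2⟩ := lt_min_iff.1 hr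
  obtain ⟨B, hB⟩ := exists_hitting_bound π hL h hn hx0 (show x < x + r by linarith)
    (by rw [hsum]; linarith)
  obtain ⟨k, hk⟩ := exists_nat_gt (1 / r)
  refine ⟨max B k, fun n hkn a hA ha happ => ?_⟩
  obtain ⟨hBn, hkn⟩ := max_le_iff.1 hkn
  have hn0 : (0 : ℝ) < n := by exact_mod_cast hA.prime.pos
  have hM : ∀ i, 0 < (n : ℝ) * L i := fun i => mul_pos hn0 (hL i)
  have hnr : 1 < r * n := by
    have h1 : (k : ℝ) ≤ n := by exact_mod_cast hkn
    have h2 := hk.trans_le h1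
    rwa [div_lt_iff₀ hr0, mul_comm] at h2
  have hsa : ((∑ i, a i : ℤ) : ℝ) = n := by rw [← hA.sum_eq]; simp
  refine ⟨fun b => (0 ≤ b ∧ b < ∑ i, a i) ∧ ∃ y ∈ Set.Ico x (x + r),
    (b : ℝ) ≤ (n : ℝ) * y ∧ (n : ℝ) * y < b + 1, ?_, ?_⟩
  · intro b hb
    have hb0 : (0 : ℝ) ≤ b := by exact_mod_cast hb.1
    have hb1 : (b : ℝ) + 1 ≤ n := by rw [← hsa]; exact_mod_cast hb.2
    have hy : (n : ℝ) * ((b + 1 / 2) / n) = b + 1 / 2 := by field_simp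
    have hymem : 0 ≤ (b + 1 / 2) / (n : ℝ) ∧ (b + 1 / 2) / (n : ℝ) < ∑ i, L i := by
      rw [hsum, div_lt_one hn0]
      exact ⟨by positivity, by linarith⟩
    obtain ⟨m, hm, hmJ⟩ := hB _ hymem
    refine ⟨m, gperm_iterate_mem π ha hb m, _, hmJ, ?_⟩
    have hε : 10 * deviation n * m ≤ 1 / 2 := by
      have h1 : (m : ℝ) ≤ n := by exact_mod_cast hm.trans hBn
      have h2 : (1 : ℝ) ≤ n := by exact_mod_cast hA.prime.pos
      unfold deviation
      rw [mul_one_div, div_mul_eq_mul_div, div_le_iff₀ (by positivity)]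
      nlinarith
    have htr := happ.track ha hM hn hb (y := b + 1 / 2) (σ := 1 / 2) le_rfl (by linarith) m hε
    rw [← gperm_mul_iterate π hL hn0 hM hymem, hy]
    exact ⟨by linarith [htr.1], htr.2⟩
  · rintro b z ⟨hb, y, hy, hy1, hy2⟩ hz1 hz2
    have hb0 : (0 : ℝ) ≤ b := by exact_mod_cast hb.1
    have hb1 : (b : ℝ) + 1 ≤ n := by rw [← hsa]; exact_mod_cast hb.2
    refine ⟨hball ?_, ?_, ?_⟩
    · rw [Metric.mem_ball, Real.dist_eq, abs_lt]
      obtain ⟨hy3, hy4⟩ := hy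
      have h1 : (n : ℝ) * (z - y) < n * r := by linarith
      have h2 : (n : ℝ) * (y - z) < n * r := by linarith
      have h3 := lt_of_mul_lt_mul_left h1 hn0.le
      have h4 := lt_of_mul_lt_mul_left h2 hn0.le
      constructor <;> linarith
    · exact nonneg_of_mul_nonneg_right (hb0.trans hz1) hn0
    · exact lt_of_mul_lt_mul_left (by linarith : (n : ℝ) * z < n * 1) hn0.le

theorem topMixingOn_of_approx (hL : ∀ i, 0 < L i) (hsum : ∑ i, L i = 1)
    (h : LinearIndependent ℚ L) (hn : Nice π)
    (happ : ∀ k : ℕ, ∃ n ≥ k, ∃ a, Admissible π n a ∧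
      ∀ i, |(n : ℝ) * L i - a i - deviation n * tau π i| < deviation n / 100) :
    TopMixingOn (ietMap π L) (Set.Ico (0 : ℝ) 1) := by
  intro U V hU hV hU' hV'
  obtain ⟨k₁, h₁⟩ := exists_atoms hL hsum h hn hU hU'
  obtain ⟨k₂, h₂⟩ := exists_atoms hL hsum h hn hV hV'
  obtain ⟨n, hkn, a, hA, hclose⟩ := happ (max k₁ k₂)
  obtain ⟨hk₁, hk₂⟩ := max_le_iff.1 hkn
  have ha : ∀ i, 0 < a i := fun i => by have := hA.three_le i; omega
  have hn0 : (0 : ℝ) < n := by exact_mod_cast hA.prime.pos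
  have hM : ∀ i, 0 < (n : ℝ) * L i := fun i => mul_pos hn0 (hL i)
  have hap : Approx π a (fun i => (n : ℝ) * L i) (deviation n) :=
    ⟨deviation_pos hA.prime.pos, fun i => (hclose i).le, by
      rw [← Finset.mul_sum, hsum, ← hA.sum_eq]; simp⟩
  obtain ⟨P, hP, hPU⟩ := h₁ n hk₁ a hA ha hap
  obtain ⟨Q, hQ, hQV⟩ := h₂ n hk₂ a hA ha hap
  have hε : 10 * deviation n * (21 * (n : ℝ) ^ 2 + 30) ≤ 1 / 2 := by
    have h2 : (1 : ℝ) ≤ n := by exact_mod_cast hA.prime.pos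
    unfold deviation
    rw [mul_one_div, div_mul_eq_mul_div, div_le_iff₀ (by positivity)]
    nlinarith
  have hmem : ∀ j, 0 ≤ lft L j ∧ lft L j < ∑ i, L i := fun j => (isAt_lft hL j).mem hL
  refine ⟨21 * n ^ 2 + 30, fun K hK => ?_⟩
  obtain ⟨z, b, c, hb, hc, h1, h2, h3, h4⟩ := hap.mixing hn ha hM hA.sum_eq hA.prime hA.odd
    hA.three_le hA.parity hε (fun i j hj m hm => by
      rw [lft_mul, lft_mul, gperm_mul_iterate π hL hn0 hM (hmem i)]
      exact fun heq => iterate_lft_ne h hn hL i hj hm (mul_left_cancel₀ hn0.ne' heq)) hP hQ hK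
  obtain ⟨x, rfl⟩ : ∃ x, z = n * x := ⟨z / n, by field_simp⟩
  have hxU := hPU b x hb h1 h2
  rw [gperm_mul_iterate π hL hn0 hM (by rw [hsum]; exact hxU.2)] at h3 h4
  refine ⟨_, ⟨x, hxU, rfl⟩, ?_⟩
  rw [show ietMap π L = gperm π L hL from funext (ietMap_eq π hL)]
  exact hQV c _ hc h3 h4

end Mixing

/-! ### The residual set -/

section Residual

/-- Length vectors close to perturbed integer vectors of arbitrarily large size. -/
def approxSet (π : Equiv.Perm (Fin 4)) (k : ℕ) : Set (Fin 4 → ℝ) :=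
  {L | ∃ n ≥ k, ∃ a, Admissible π n a ∧
    ∀ i, |(n : ℝ) * L i - a i - deviation n * tau π i| < deviation n / 100}

theorem isOpen_approxSet (π : Equiv.Perm (Fin 4)) (k : ℕ) : IsOpen (approxSet π k) := by
  rw [isOpen_iff_mem_nhds]
  rintro L ⟨n, hn, a, hA, h⟩
  have ho : IsOpen {L : Fin 4 → ℝ |
      ∀ i, |(n : ℝ) * L i - a i - deviation n * tau π i| < deviation n / 100} := by
    simp only [Set.ofPred_forall]
    exact isOpen_iInter_of_finite fun i => isOpen_lt (by fun_prop) continuous_const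
  filter_upwards [ho.mem_nhds h] with L' hL'
  exact ⟨n, hn, a, hA, hL'⟩

theorem exists_admissible {π : Equiv.Perm (Fin 4)} (hπ : Nice π) {n : ℕ} (hn : n.Prime)
    (hodd : Odd n) {x : Fin 4 → ℝ} (hx : ∀ i, 9 ≤ x i) (hs : ∑ i, x i = n) :
    ∃ a, Admissible π n a ∧ ∀ i, |a i - x i| ≤ 6 := by
  obtain ⟨e, he1, he2, he3⟩ := hπ.parity
  let f : Fin 4 → ℤ := fun i => 2 * ⌊x i / 2⌋ + e i
  have hf : ∀ i, |(f i : ℝ) - x i| ≤ 2 := by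
    intro i
    have h1 := Int.floor_le (x i / 2)
    have h2 := Int.lt_floor_add_one (x i / 2)
    have h3 : (e i : ℝ) ≤ 1 := by exact_mod_cast he1 i
    have h4 : (0 : ℝ) ≤ e i := by positivity
    simp only [f, abs_le]
    push_cast
    constructor <;> linarith
  let a : Fin 4 → ℤ := ![f 0, f 1, f 2, n - f 0 - f 1 - f 2]
  have ha : ∀ i, |(a i : ℝ) - x i| ≤ 6 := by
    have h0 := abs_le.1 (hf 0)
    have h1 := abs_le.1 (hf 1)
    have h2 := abs_le.1 (hf 2)
    rw [Fin.sum_univ_four] at hs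
    intro i
    rw [abs_le]
    fin_cases i
    · simp [a]; constructor <;> linarith
    · simp [a]; constructor <;> linarith
    · simp [a]; constructor <;> linarith
    · simp [a]; constructor <;> linarith
  refine ⟨a, ⟨hn, hodd, ?_, fun i => ?_, e, fun i => ?_, he3⟩, ha⟩
  · simp [a, Fin.sum_univ_four]
  · have h1 := abs_le.1 (ha i)
    have h2 := hx i
    have : (3 : ℝ) ≤ a i := by linarith
    exact_mod_cast this
  · rw [Fin.sum_univ_four] at he2
    obtain ⟨m, hm⟩ := he2
    obtain ⟨l, hl⟩ := hodd
    fin_cases i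
    · simp [a, f]
    · simp [a, f]
    · simp [a, f]
    · simp [a, f]; omega

theorem exists_mem_approxSet {π : Equiv.Perm (Fin 4)} (hπ : Nice π) (k : ℕ) {L : Fin 4 → ℝ}
    (hL : L ∈ stdSimplex ℝ (Fin 4)) {δ : ℝ} (hδ : 0 < δ) :
    ∃ L' ∈ stdSimplex ℝ (Fin 4), L' ∈ approxSet π k ∧ dist L' L < δ := by
  obtain ⟨t, ht0, ht⟩ := exists_between (lt_min (half_pos hδ) one_pos)
  obtain ⟨ht1, ht2⟩ := lt_min_iff.1 ht
  obtain ⟨l, hl⟩ := exists_nat_gt (max (36 / t) (14 / δ))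
  obtain ⟨hl1, hl2⟩ := max_lt_iff.1 hl
  obtain ⟨n, hn, hp⟩ := Nat.exists_infinite_primes (max (max k l) 3)
  obtain ⟨hn', hn3⟩ := max_le_iff.1 hn
  obtain ⟨hkn, hln⟩ := max_le_iff.1 hn'
  have hodd : Odd n := hp.odd_of_ne_two (by omega)
  have hn0 : (0 : ℝ) < n := by exact_mod_cast hp.pos
  have hln' : (l : ℝ) ≤ n := by exact_mod_cast hln
  have e1 : 36 < n * t := (div_lt_iff₀ ht0).1 (hl1.trans_le hln')
  have e2 : 14 < n * δ := (div_lt_iff₀ hδ).1 (hl2.trans_le hln')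
  let y : Fin 4 → ℝ := fun i => (1 - t) * L i + t / 4
  have hLi : ∀ i, 0 ≤ L i ∧ L i ≤ 1 := fun i => mem_Icc_of_mem_stdSimplex hL i
  have hyL : ∀ i, |y i - L i| ≤ t := by
    intro i
    obtain ⟨h0, h1⟩ := hLi i
    rw [abs_le]
    simp only [y]
    constructor <;> nlinarith
  obtain ⟨a, hA, ha⟩ := exists_admissible hπ hp hodd (x := fun i => n * y i)
    (fun i => by
      have h1 : t / 4 ≤ y i := by
        have := mul_nonneg (sub_nonneg.2 ht2.le) (hLi i).1
        simp only [y]; linarith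
      have := mul_le_mul_of_nonneg_left h1 hn0.le
      linarith)
    (by
      rw [← Finset.mul_sum]
      simp only [y, Finset.sum_add_distrib, ← Finset.mul_sum, hL.2]
      simp; ring)
  have hd0 := deviation_pos hp.pos
  have hd1 : deviation n ≤ 1 / 10 := by
    have h2 : (1 : ℝ) ≤ n := by exact_mod_cast hp.pos
    unfold deviation
    rw [div_le_div_iff₀ (by positivity) (by norm_num)]
    nlinarith
  have hτ : ∀ i, |deviation n * tau π i| ≤ 3 / 10 := by
    intro i
    rw [abs_mul, abs_of_pos hd0]
    have h1 : |(tau π i : ℝ)| ≤ 3 := by exact_mod_cast hπ.tau_le i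
    have := mul_le_mul hd1 h1 (abs_nonneg _) (by norm_num)
    linarith
  have hmul : ∀ i, (n : ℝ) * ((a i + deviation n * tau π i) / n) = a i + deviation n * tau π i :=
    fun i => by field_simp
  refine ⟨fun i => (a i + deviation n * tau π i) / n, ⟨fun i => ?_, ?_⟩, ⟨n, hkn, a, hA, fun i => ?_⟩,
    (dist_pi_lt_iff hδ).2 fun i => ?_⟩
  · have h1 : (3 : ℝ) ≤ a i := by exact_mod_cast hA.three_le i
    have h2 := abs_le.1 (hτ i)
    exact div_nonneg (by linarith) hn0.le
  · rw [← Finset.sum_div, Finset.sum_add_distrib, ← Finset.mul_sum]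
    have h1 : ∑ i, (a i : ℝ) = n := by exact_mod_cast hA.sum_eq.symm
    have h2 : ∑ i, (tau π i : ℝ) = 0 := by exact_mod_cast hπ.tau_sum
    rw [h1, h2, mul_zero, add_zero, div_self hn0.ne']
  · rw [hmul]
    simp only [add_sub_cancel_left, sub_self, abs_zero]
    positivity
  · have h1 := abs_le.1 (ha i)
    have h2 := abs_le.1 (hτ i)
    have h3 := abs_le.1 (hyL i)
    have h4 := hmul i
    rw [Real.dist_eq, abs_lt]
    set z := (a i + deviation n * tau π i) / (n : ℝ)
    have h5 : (n : ℝ) * (z - y i) < n * (δ / 2) := by linarith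
    have h6 : (n : ℝ) * (y i - z) < n * (δ / 2) := by linarith
    have h7 := lt_of_mul_lt_mul_left h5 hn0.le
    have h8 := lt_of_mul_lt_mul_left h6 hn0.le
    constructor <;> linarith

theorem dense_preimage_approxSet {π : Equiv.Perm (Fin 4)} (hπ : Nice π) (k : ℕ) :
    Dense ((Subtype.val : stdSimplex ℝ (Fin 4) → _) ⁻¹' approxSet π k) := by
  rw [Metric.dense_iff]
  intro L δ hδ
  obtain ⟨L', h1, h2, h3⟩ := exists_mem_approxSet hπ k L.2 hδ
  exact ⟨⟨L', h1⟩, h3, h2⟩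

/-- Length vectors not satisfying a given rational relation. -/
def offHyperplane (c : Fin 4 → ℤ) : Set (Fin 4 → ℝ) := {L | ∑ i, c i * L i ≠ 0}

theorem isOpen_offHyperplane (c : Fin 4 → ℤ) : IsOpen (offHyperplane c) :=
  isOpen_ne_fun (by fun_prop) continuous_const

theorem dense_preimage_offHyperplane {c : Fin 4 → ℤ} (hc : c ≠ 0) :
    Dense ((Subtype.val : stdSimplex ℝ (Fin 4) → _) ⁻¹' offHyperplane c) := by
  rw [Metric.dense_iff]
  intro L δ hδ
  by_cases hL : ∑ i, c i * L.1 i = 0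
  · obtain ⟨k, hk⟩ := Function.ne_iff.1 hc
    obtain ⟨t, ht0, ht⟩ := exists_between (lt_min hδ one_pos)
    obtain ⟨ht1, ht2⟩ := lt_min_iff.1 ht
    refine ⟨⟨fun i => (1 - t) * L.1 i + t * (if i = k then 1 else 0), fun i => ?_, ?_⟩, ?_, ?_⟩
    · have := mul_nonneg (sub_nonneg.2 ht2.le) (L.2.1 i)
      show 0 ≤ (1 - t) * L.1 i + t * (if i = k then (1 : ℝ) else 0)
      split_ifs <;> linarith
    · rw [Finset.sum_add_distrib, ← Finset.mul_sum, ← Finset.mul_sum, L.2.2]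
      simp
    · rw [Metric.mem_ball, Subtype.dist_eq, dist_pi_lt_iff hδ]
      intro i
      have h1 := mem_Icc_of_mem_stdSimplex L.2 i
      obtain ⟨h0, h1⟩ := h1
      rw [Real.dist_eq, abs_lt]
      show -δ < (1 - t) * L.1 i + t * (if i = k then (1 : ℝ) else 0) - L.1 i ∧
        (1 - t) * L.1 i + t * (if i = k then (1 : ℝ) else 0) - L.1 i < δ
      split_ifs <;> constructor <;> nlinarith
    · show ∑ i, (c i : ℝ) * ((1 - t) * L.1 i + t * (if i = k then 1 else 0)) ≠ 0
      have : ∑ i, (c i : ℝ) * ((1 - t) * L.1 i + t * (if i = k then 1 else 0)) =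
          (1 - t) * ∑ i, c i * L.1 i + t * c k := by
        rw [Finset.mul_sum]
        simp only [mul_add, Finset.sum_add_distrib]
        congr 1
        · exact Finset.sum_congr rfl fun i _ => by ring
        · simp [mul_comm]
      rw [this, hL, mul_zero, zero_add]
      exact mul_ne_zero ht0.ne' (by exact_mod_cast hk)
  · exact ⟨L, Metric.mem_ball_self hδ, hL⟩

theorem linearIndependent_of_offHyperplane {L : Fin 4 → ℝ}
    (h : ∀ c : Fin 4 → ℤ, c ≠ 0 → L ∈ offHyperplane c) : LinearIndependent ℚ L := by
  rw [← LinearIndependent.iff_fractionRing ℤ ℚ, Fintype.linearIndependent_iff]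
  intro c hc
  by_contra! hne
  obtain ⟨i, hi⟩ := hne
  refine h c (fun h0 => hi (congrFun h0 i)) ?_
  simpa using hc

end Residual

/-- For a permutation `π` of `{1,2,3,4}` in the Rauzy class of `(4321)`,
the set of length vectors `L ∈ Δ₃` with strictly positive entries such that `T_{L,π}`
is topologically mixing is residual in `Δ₃`. -/
theorem residual_set_topologically_mixing_R4 (π : Equiv.Perm (Fin 4))
    (hπ : InRauzyClass perm4321 π) :
    ∃ G : Set (stdSimplex ℝ (Fin 4)), IsGδ G ∧ Dense G ∧
      ∀ L ∈ G, (∀ i, 0 < (L : Fin 4 → ℝ) i) ∧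
        TopMixingOn (ietMap π (L : Fin 4 → ℝ)) (Set.Ico (0 : ℝ) 1) := by
  have hn := hπ.nice
  let O : ℕ ⊕ {c : Fin 4 → ℤ // c ≠ 0} → Set (stdSimplex ℝ (Fin 4)) :=
    Sum.elim (fun k => Subtype.val ⁻¹' approxSet π k) (fun c => Subtype.val ⁻¹' offHyperplane c)
  have hopen : ∀ s, IsOpen (O s) := by
    rintro (k | c)
    · exact (isOpen_approxSet π k).preimage continuous_subtype_val
    · exact (isOpen_offHyperplane c).preimage continuous_subtype_val
  have hdense : ∀ s, Dense (O s) := by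
    rintro (k | c)
    · exact dense_preimage_approxSet hn k
    · exact dense_preimage_offHyperplane c.2
  refine ⟨⋂ s, O s, .iInter_of_isOpen hopen, dense_iInter_of_isOpen hopen hdense, ?_⟩
  intro L hL
  rw [Set.mem_iInter] at hL
  have happ : ∀ k, (L : Fin 4 → ℝ) ∈ approxSet π k := fun k => hL (Sum.inl k)
  have hoff : ∀ c : Fin 4 → ℤ, c ≠ 0 → (L : Fin 4 → ℝ) ∈ offHyperplane c :=
    fun c hc => hL (Sum.inr ⟨c, hc⟩)
  have hli := linearIndependent_of_offHyperplane hoff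
  have hpos : ∀ i, 0 < (L : Fin 4 → ℝ) i := fun i => lt_of_le_of_ne (L.2.1 i) (hli.ne_zero i).symm
  exact ⟨hpos, topMixingOn_of_approx hpos L.2.2 hli hn happ⟩

end IETPaper
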